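/- (Inverse Cayley–Hamilton–Newton identities.) Let R̂ be a Hecke R-matrix for the parameter q with m_q ≠ 0 for all m ≥ 1, let F̂ be a closed R-matrix compatible with R̂, and let M be a matrix of generators of M(R̂,F̂) over a unital associative k-algebra A. Then for every k ≥ 1 the k-th power is expressed through wedge and symmetric powers as: M^{‾k} = Σ_{i=1}^{k} (−1)^{i+1} q^{k−i} i_q M^{∧i} τ_{k−i}(M) = Σ_{i=1}^{k} (−1)^{k−i} q^{i−k} i_q M^{S i} σ_{k−i}(M). -/

import Mathlib

/-! Common definitions for quantum matrix algebras `M(R̂,F̂)` in the sense of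
Isaev–Ogievetsky–Pyatov, "On quantum matrix algebras satisfying the
Cayley-Hamilton-Newton identities".

We model operators on `V^{⊗m}` (where `dim V = N`) as matrices indexed by
multi-indices `Fin m → Fin N`; entries are taken in a (possibly
noncommutative) unital associative algebra `A` over a field `K`.
Sites (tensor factors) are numbered starting from `0`, so the paper's
`X_i` is `site m (i-1) X`, and the paper's `M_{\overline{k}}` is
`Mbar m F F⁻¹ M (k-1)`. -/

namespace CHN

noncomputable section

/-- Operators on `V^{⊗m}` (`dim V = N`) with entries in a ring `A`. -/
abbrev Op (N : ℕ) (A : Type*) [Ring A] (m : ℕ) :=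
  Matrix (Fin m → Fin N) (Fin m → Fin N) A

/-- Operators on `V ⊗ V`. -/
abbrev M2 (N : ℕ) (A : Type*) [Ring A] :=
  Matrix (Fin N × Fin N) (Fin N × Fin N) A

/-- `site m i X` places the two-site operator `X` at the (0-based) tensor
factors `i, i+1` of `V^{⊗m}`, acting as the identity elsewhere.  In the
paper's 1-based notation, `X_i = site m (i-1) X`.  (Out of range it is the
identity.) -/
def site {A : Type*} [Ring A] {N : ℕ} (m i : ℕ) (X : M2 N A) : Op N A m :=
  fun a b =>
    if h : i + 1 < m then
      X (a ⟨i, Nat.lt_of_succ_lt h⟩, a ⟨i + 1, h⟩)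
          (b ⟨i, Nat.lt_of_succ_lt h⟩, b ⟨i + 1, h⟩) *
        (if ∀ j : Fin m, (j : ℕ) ≠ i → (j : ℕ) ≠ i + 1 → a j = b j then 1 else 0)
    else if a = b then 1 else 0

/-- `site1 m i X` places the one-site operator `X` at the (0-based) factor `i`. -/
def site1 {A : Type*} [Ring A] {N : ℕ} (m i : ℕ) (X : Matrix (Fin N) (Fin N) A) :
    Op N A m :=
  fun a b =>
    if h : i < m then
      X (a ⟨i, h⟩) (b ⟨i, h⟩) *
        (if ∀ j : Fin m, (j : ℕ) ≠ i → a j = b j then 1 else 0)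
    else if a = b then 1 else 0

/-- `chain m X i l = X_i X_{i+1} ⋯ X_{i+l-1}` (0-based sites, `l` factors); in
the paper's 1-based notation this is `X_{i+1 → i+l}`. -/
def chain {A : Type*} [Ring A] {N : ℕ} (m : ℕ) (X : M2 N A) (i : ℕ) :
    ℕ → Op N A m
  | 0 => 1
  | l + 1 => chain m X i l * site m (i + l) X

/-- The Yang–Baxter equation `X₁X₂X₁ = X₂X₁X₂` on `V^{⊗3}`. -/
def YB {A : Type*} [Ring A] {N : ℕ} (X : M2 N A) : Prop :=
  site 3 0 X * site 3 1 X * site 3 0 X = site 3 1 X * site 3 0 X * site 3 1 X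

/-- Compatibility of a pair of R-matrices: both Yang–Baxter equations together
with the conditions `R̂₁F̂₂F̂₁ = F̂₂F̂₁R̂₂` and `F̂₁F̂₂R̂₁ = R̂₂F̂₁F̂₂` on `V^{⊗3}`. -/
def Compatible {A : Type*} [Ring A] {N : ℕ} (R F : M2 N A) : Prop :=
  YB R ∧ YB F ∧
    site 3 0 R * site 3 1 F * site 3 0 F = site 3 1 F * site 3 0 F * site 3 1 R ∧
    site 3 0 F * site 3 1 F * site 3 0 R = site 3 1 R * site 3 0 F * site 3 1 F

/-- `Ψ` witnesses closedness of `F̂`:  `Ψ^{af}_{cg} F̂^{gb}_{fd} = δ^a_d δ^b_c`. -/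
def IsClosedPair {A : Type*} [Ring A] {N : ℕ} (F Ψ : M2 N A) : Prop :=
  ∀ a b c d : Fin N,
    (∑ f : Fin N, ∑ g : Fin N, Ψ (a, f) (c, g) * F (g, b) (f, d)) =
      if a = d ∧ b = c then 1 else 0

/-- The matrix `D`, `D^a_b := Ψ^{ac}_{bc}`. -/
def Dmat {A : Type*} [Ring A] {N : ℕ} (Ψ : M2 N A) : Matrix (Fin N) (Fin N) A :=
  fun a b => ∑ c : Fin N, Ψ (a, c) (b, c)

/-- Quantum trace (with weight `D`) over the last tensor factor. -/
def qtr1 {K : Type*} [Field K] {A : Type*} [Ring A] [Algebra K A] {N m : ℕ}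
    (D : Matrix (Fin N) (Fin N) K) (X : Op N A (m + 1)) : Op N A m :=
  fun a b => ∑ c : Fin N, ∑ e : Fin N,
    algebraMap K A (D c e) * X (Fin.snoc a e) (Fin.snoc b c)

/-- Quantum trace over the last `j` tensor factors. -/
def qtrs {K : Type*} [Field K] {A : Type*} [Ring A] [Algebra K A] {N : ℕ}
    (D : Matrix (Fin N) (Fin N) K) (m : ℕ) :
    (j : ℕ) → Op N A (m + j) → Op N A m
  | 0, X => X
  | j + 1, X => qtrs D m j (qtr1 D X)

/-- Full quantum trace `Tr_F(1,…,m)`, with values in `A`. -/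
def qtrAll {K : Type*} [Field K] {A : Type*} [Ring A] [Algebra K A] {N m : ℕ}
    (D : Matrix (Fin N) (Fin N) K) (X : Op N A m) : A :=
  ∑ a : Fin m → Fin N, ∑ b : Fin m → Fin N,
    algebraMap K A (∏ i, D (a i) (b i)) * X b a

/-- Quantum trace of a one-site operator:  `Tr_F X = Tr (D X)`. -/
def trF {K : Type*} [Field K] {A : Type*} [Ring A] [Algebra K A] {N : ℕ}
    (D : Matrix (Fin N) (Fin N) K) (X : Matrix (Fin N) (Fin N) A) : A :=
  ∑ a : Fin N, ∑ b : Fin N, algebraMap K A (D a b) * X b a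

/-- Ordinary partial trace over the last tensor factor. -/
def ptr1 {A : Type*} [Ring A] {N m : ℕ} (X : Op N A (m + 1)) : Op N A m :=
  fun a b => ∑ c : Fin N, X (Fin.snoc a c) (Fin.snoc b c)

/-- Ordinary partial trace over the last `j` tensor factors. -/
def ptrs {A : Type*} [Ring A] {N : ℕ} (m : ℕ) :
    (j : ℕ) → Op N A (m + j) → Op N A m
  | 0, X => X
  | j + 1, X => ptrs m j (ptr1 X)

/-- `Mbar m F Finv M k` is the paper's `M_{\overline{k+1}}` (0-based index `k`):
`M_{\overline{1}} := M₁` and `M_{\overline{k+1}} := F̂_k M_{\overline{k}} F̂_k⁻¹`. -/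
def Mbar {A : Type*} [Ring A] {N : ℕ} (m : ℕ) (F Finv : M2 N A)
    (M : Matrix (Fin N) (Fin N) A) : ℕ → Op N A m
  | 0 => site1 m 0 M
  | k + 1 => site m k F * Mbar m F Finv M k * site m k Finv

/-- `MbarSeg m F Finv M i l = M_{\overline{i+1}} M_{\overline{i+2}} ⋯ M_{\overline{i+l}}`,
the ordered product of `l` consecutive copies starting at 0-based index `i`.
In particular `MbarSeg m F Finv M 0 k = M_{\overline{1}} ⋯ M_{\overline{k}}`. -/
def MbarSeg {A : Type*} [Ring A] {N : ℕ} (m : ℕ) (F Finv : M2 N A)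
    (M : Matrix (Fin N) (Fin N) A) (i : ℕ) : ℕ → Op N A m
  | 0 => 1
  | l + 1 => MbarSeg m F Finv M i l * Mbar m F Finv M (i + l)

/-- The double twist `R̂^{FF} = F̂ (F̂ R̂ F̂⁻¹) F̂⁻¹`. -/
def RFF {K : Type*} [Field K] {N : ℕ} (R F : M2 N K) : M2 N K :=
  F * (F * R * F⁻¹) * F⁻¹

/-- `M` is a matrix of generators of the algebra `M(R̂,F̂)`:
`R̂₁ M_{\overline{1}} M_{\overline{2}} = M_{\overline{1}} M_{\overline{2}} (R̂^{FF})₁`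
on `V ⊗ V`. -/
def IsGenerators {K : Type*} [Field K] {A : Type*} [Ring A] [Algebra K A] {N : ℕ}
    (R F : M2 N K) (M : Matrix (Fin N) (Fin N) A) : Prop :=
  site 2 0 (R.map (algebraMap K A)) *
      MbarSeg 2 (F.map (algebraMap K A)) ((F⁻¹).map (algebraMap K A)) M 0 2 =
    MbarSeg 2 (F.map (algebraMap K A)) ((F⁻¹).map (algebraMap K A)) M 0 2 *
      site 2 0 ((RFF R F).map (algebraMap K A))

/-- Evaluation of a noncommutative polynomial `Y` in `v` variables, substituting
for the variable `x_j` the operator `R̂` placed at the (0-based) sites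
`p+j, p+j+1` of `V^{⊗m}`.  For `p = 0` this is the paper's
`Y^{(v+1)} = Y^{(v+1)}(R̂₁,…,R̂_v)`, and a general `p` gives `Y^{(p+1,v+1)}`. -/
def evalY {K : Type*} [Field K] {A : Type*} [Ring A] [Algebra K A] {N m v : ℕ}
    (R : M2 N A) (p : ℕ) (Y : FreeAlgebra K (Fin v)) : Op N A m :=
  FreeAlgebra.lift K (fun j : Fin v => site m (p + (j : ℕ)) R) Y

/-- `Ustack m R k l = R̂_{l → l+k-1} ⋯ R̂_{2 → k+1} R̂_{1 → k}` (1-based labels):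
the product of `l` descending chains of length `k`. -/
def Ustack {A : Type*} [Ring A] {N : ℕ} (m : ℕ) (R : M2 N A) (k : ℕ) :
    ℕ → Op N A m
  | 0 => 1
  | l + 1 => chain m R l k * Ustack m R k l

/-- The `q`-number `n_q = (qⁿ − q⁻ⁿ)/(q − q⁻¹)`. -/
def qInt {K : Type*} [Field K] (q : K) (n : ℕ) : K :=
  (q ^ n - q⁻¹ ^ n) / (q - q⁻¹)

/-- `R̂` is a Hecke R-matrix for the parameter `q`:  it is invertible, satisfies
the Yang–Baxter equation and the Hecke condition `R̂² = 1 + (q − q⁻¹)R̂`. -/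
def IsHecke {K : Type*} [Field K] {N : ℕ} (q : K) (R : M2 N K) : Prop :=
  IsUnit R ∧ YB R ∧ R * R = 1 + (q - q⁻¹) • R

/-- The `q`-antisymmetrizer `A^{(k)}` built from `R̂`, placed at the (0-based)
tensor factors `p, p+1, …, p+k-1` of `V^{⊗m}`. -/
def qasym {K : Type*} [Field K] {N : ℕ} (q : K) (R : M2 N K) (m p : ℕ) :
    ℕ → Op N K m
  | 0 => 1
  | 1 => 1
  | k + 2 =>
      (qInt q (k + 2))⁻¹ •
        (qasym q R m p (k + 1) *
          (q ^ (k + 1) • (1 : Op N K m) - qInt q (k + 1) • site m (p + k) R) *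
          qasym q R m p (k + 1))

/-- The `q`-symmetrizer `S^{(k)}` built from `R̂`, placed at the (0-based)
tensor factors `p, p+1, …, p+k-1` of `V^{⊗m}`. -/
def qsym {K : Type*} [Field K] {N : ℕ} (q : K) (R : M2 N K) (m p : ℕ) :
    ℕ → Op N K m
  | 0 => 1
  | 1 => 1
  | k + 2 =>
      (qInt q (k + 2))⁻¹ •
        (qsym q R m p (k + 1) *
          (q⁻¹ ^ (k + 1) • (1 : Op N K m) + qInt q (k + 1) • site m (p + k) R) *
          qsym q R m p (k + 1))

/-- The elementary symmetric function
`σ_k(M) = Tr_F(1,…,k)(A^{(k)} M_{\overline{1}}⋯M_{\overline{k}})` (with `σ_0 = 1`). -/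
def sigmaF {K : Type*} [Field K] {A : Type*} [Ring A] [Algebra K A] {N : ℕ}
    (q : K) (R F Ψ : M2 N K) (M : Matrix (Fin N) (Fin N) A) (k : ℕ) : A :=
  qtrAll (Dmat Ψ)
    ((qasym q R k 0 k).map (algebraMap K A) *
      MbarSeg k (F.map (algebraMap K A)) ((F⁻¹).map (algebraMap K A)) M 0 k)

/-- The complete symmetric function
`τ_k(M) = Tr_F(1,…,k)(S^{(k)} M_{\overline{1}}⋯M_{\overline{k}})` (with `τ_0 = 1`). -/
def tauF {K : Type*} [Field K] {A : Type*} [Ring A] [Algebra K A] {N : ℕ}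
    (q : K) (R F Ψ : M2 N K) (M : Matrix (Fin N) (Fin N) A) (k : ℕ) : A :=
  qtrAll (Dmat Ψ)
    ((qsym q R k 0 k).map (algebraMap K A) *
      MbarSeg k (F.map (algebraMap K A)) ((F⁻¹).map (algebraMap K A)) M 0 k)

/-- The power sums `s_k(M) = Tr_F(1,…,k)(R̂_{1→k−1} M_{\overline{1}}⋯M_{\overline{k}})`,
with `s_0 = 1`. -/
def sF {K : Type*} [Field K] {A : Type*} [Ring A] [Algebra K A] {N : ℕ}
    (R F Ψ : M2 N K) (M : Matrix (Fin N) (Fin N) A) : ℕ → A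
  | 0 => 1
  | j + 1 =>
      qtrAll (Dmat Ψ)
        (chain (j + 1) (R.map (algebraMap K A)) 0 j *
          MbarSeg (j + 1) (F.map (algebraMap K A)) ((F⁻¹).map (algebraMap K A)) M 0 (j + 1))

/-- The `(j+1)`-st quantum power of `M`,
`M^{\overline{j+1}} = Tr_F(2,…,j+1)(R̂_{1→j} M_{\overline{1}}⋯M_{\overline{j+1}})`,
as a one-site operator (so `MpowF R F Ψ M 0 = M₁ = M`). -/
def MpowF {K : Type*} [Field K] {A : Type*} [Ring A] [Algebra K A] {N : ℕ}
    (R F Ψ : M2 N K) (M : Matrix (Fin N) (Fin N) A) (j : ℕ) : Op N A 1 :=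
  qtrs (Dmat Ψ) 1 j
    (chain (1 + j) (R.map (algebraMap K A)) 0 j *
      MbarSeg (1 + j) (F.map (algebraMap K A)) ((F⁻¹).map (algebraMap K A)) M 0 (j + 1))

/-- The `(j+1)`-st wedge power of `M`,
`M^{∧(j+1)} = Tr_F(2,…,j+1)(A^{(j+1)} M_{\overline{1}}⋯M_{\overline{j+1}})`. -/
def MwedgeF {K : Type*} [Field K] {A : Type*} [Ring A] [Algebra K A] {N : ℕ}
    (q : K) (R F Ψ : M2 N K) (M : Matrix (Fin N) (Fin N) A) (j : ℕ) : Op N A 1 :=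
  qtrs (Dmat Ψ) 1 j
    ((qasym q R (1 + j) 0 (j + 1)).map (algebraMap K A) *
      MbarSeg (1 + j) (F.map (algebraMap K A)) ((F⁻¹).map (algebraMap K A)) M 0 (j + 1))

/-- The `(j+1)`-st symmetric power of `M`,
`M^{S(j+1)} = Tr_F(2,…,j+1)(S^{(j+1)} M_{\overline{1}}⋯M_{\overline{j+1}})`. -/
def MsymF {K : Type*} [Field K] {A : Type*} [Ring A] [Algebra K A] {N : ℕ}
    (q : K) (R F Ψ : M2 N K) (M : Matrix (Fin N) (Fin N) A) (j : ℕ) : Op N A 1 :=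
  qtrs (Dmat Ψ) 1 j
    ((qsym q R (1 + j) 0 (j + 1)).map (algebraMap K A) *
      MbarSeg (1 + j) (F.map (algebraMap K A)) ((F⁻¹).map (algebraMap K A)) M 0 (j + 1))

/-- `M^{\overline{0}} := q^{-n} n_q Tr_{(2,…,n)}(A^{(n)}) D^{-1}`, with `n = n0 + 1`
(an ordinary, non-quantum, trace over the factors `2,…,n`). -/
def MzeroF {K : Type*} [Field K] {N : ℕ} (q : K) (R Ψ : M2 N K) (n0 : ℕ) :
    Op N K 1 :=
  (q⁻¹ ^ (n0 + 1) * qInt q (n0 + 1)) •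
    (ptrs 1 n0 (qasym q R (1 + n0) 0 (n0 + 1)) * site1 1 0 ((Dmat Ψ)⁻¹))

/-- The generators of the characteristic subalgebra: all elements
`α(Y^{(k)}) = Tr_F(1,…,k)(Y^{(k)} M_{\overline{1}}⋯M_{\overline{k}})`, `k ≥ 1`. -/
def charSet {K : Type*} [Field K] {A : Type*} [Ring A] [Algebra K A] {N : ℕ}
    (R F Ψ : M2 N K) (M : Matrix (Fin N) (Fin N) A) : Set A :=
  { x : A | ∃ (v : ℕ) (Y : FreeAlgebra K (Fin v)),
      x = qtrAll (Dmat Ψ)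
        (evalY (R.map (algebraMap K A)) 0 Y *
          MbarSeg (v + 1) (F.map (algebraMap K A)) ((F⁻¹).map (algebraMap K A)) M 0 (v + 1)) }

end

/-! ### `q`-numbers -/

section QInt

variable {K : Type*} [Field K] {q : K}

theorem qInt_zero : qInt q 0 = 0 := by simp [qInt]

theorem qInt_add (hq : q ≠ 0) (a b : ℕ) :
    qInt q (a + b) = q ^ b * qInt q a + q⁻¹ ^ a * qInt q b := by
  have : q ^ a * q⁻¹ ^ a = 1 := by rw [← mul_pow, mul_inv_cancel₀ hq, one_pow]
  have : q ^ b * q⁻¹ ^ b = 1 := by rw [← mul_pow, mul_inv_cancel₀ hq, one_pow]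
  simp only [qInt, mul_div_assoc', ← add_div]
  congr 1
  rw [pow_add, pow_add]
  ring

theorem qInt_one (hq : q - q⁻¹ ≠ 0) : qInt q 1 = 1 := by
  simp [qInt, div_self hq]

theorem neg_inv_sub_inv (q : K) : -q⁻¹ - (-q⁻¹)⁻¹ = q - q⁻¹ := by
  rw [inv_neg, inv_inv]; ring

theorem qInt_neg_inv (q : K) (n : ℕ) : qInt (-q⁻¹) (n + 1) = (-1) ^ n * qInt q (n + 1) := by
  rw [qInt, qInt, neg_inv_sub_inv, inv_neg, inv_inv, neg_pow, neg_pow q, pow_succ (-1 : K) n]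
  ring

end QInt

/-! ### Antisymmetrizers in a quotient of a Hecke algebra -/

section Hecke

variable {K : Type*} [Field K] {E : Type*} [Ring E] [Algebra K E]

/-- The elements `R 0, …, R (L - 1)` satisfy the relations of the Hecke algebra of type `A_L`. -/
structure IsHeckeSeq (q : K) (R : ℕ → E) (L : ℕ) : Prop where
  quad : ∀ i < L, R i * R i = 1 + (q - q⁻¹) • R i
  braid : ∀ i, i + 1 < L → R i * R (i + 1) * R i = R (i + 1) * R i * R (i + 1)
  far : ∀ i j, i + 1 < j → j < L → R i * R j = R j * R i

/-- The antisymmetrizer of the Hecke algebra generated by `R p, …, R (p + n - 2)`. -/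
def asym (q : K) (R : ℕ → E) (p : ℕ) : ℕ → E
  | 0 => 1
  | 1 => 1
  | k + 2 =>
      (qInt q (k + 2))⁻¹ •
        (asym q R p (k + 1) * (q ^ (k + 1) • (1 : E) - qInt q (k + 1) • R (p + k)) *
          asym q R p (k + 1))

theorem asym_succ_succ (q : K) (R : ℕ → E) (p k : ℕ) : asym q R p (k + 2) =
    (qInt q (k + 2))⁻¹ •
        (asym q R p (k + 1) * (q ^ (k + 1) • (1 : E) - qInt q (k + 1) • R (p + k)) *
          asym q R p (k + 1)) := rfl

theorem asym_mem {q : K} {R : ℕ → E} {p : ℕ} (S : Subalgebra K E) :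
    ∀ n, (∀ i, p ≤ i → i + 1 < p + n → R i ∈ S) → asym q R p n ∈ S
  | 0, _ => S.one_mem
  | 1, _ => S.one_mem
  | k + 2, h => by
    have ih : asym q R p (k + 1) ∈ S := asym_mem S (k + 1) fun i hi hk => h i hi (by omega)
    exact S.smul_mem (S.mul_mem (S.mul_mem ih (S.sub_mem (S.smul_mem S.one_mem _)
      (S.smul_mem (h _ (by omega) (by omega)) _))) ih) _

theorem commute_asym {q : K} {R : ℕ → E} {p n : ℕ} {Z : E}
    (h : ∀ i, p ≤ i → i + 1 < p + n → Commute Z (R i)) : Commute Z (asym q R p n) := by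
  have := asym_mem (q := q) (R := R) (p := p) (Subalgebra.centralizer K {Z}) n
    fun i hi hn => by
      rw [Subalgebra.mem_centralizer_iff]
      rintro _ rfl
      exact h i hi hn
  rw [Subalgebra.mem_centralizer_iff] at this
  exact this Z rfl

theorem mul_asym_eq_asym_mul {q : K} {R R' : ℕ → E} {p p' : ℕ} {G : E} :
    ∀ n, (∀ i, i + 1 < n → G * R (p + i) = R' (p' + i) * G) →
      G * asym q R p n = asym q R' p' n * G
  | 0, _ => by simp [asym]
  | 1, _ => by simp [asym]
  | k + 2, h => by
    have ih : G * asym q R p (k + 1) = asym q R' p' (k + 1) * G :=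
      mul_asym_eq_asym_mul (k + 1) fun i hk => h i (by omega)
    have h1 : G * (q ^ (k + 1) • (1 : E) - qInt q (k + 1) • R (p + k)) =
        (q ^ (k + 1) • (1 : E) - qInt q (k + 1) • R' (p' + k)) * G := by
      simp only [mul_sub, sub_mul, mul_smul_comm, smul_mul_assoc, mul_one, one_mul,
        h k (by omega)]
    rw [asym_succ_succ, asym_succ_succ, mul_smul_comm, smul_mul_assoc]
    congr 1
    rw [← mul_assoc, ← mul_assoc, ih, mul_assoc _ G, h1, mul_assoc, mul_assoc, mul_assoc, ih]
    simp only [mul_assoc]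

theorem map_asym {E' : Type*} [Ring E'] [Algebra K E'] (f : E →ₐ[K] E') {q : K} {R : ℕ → E}
    {R' : ℕ → E'} {p : ℕ} : ∀ n, (∀ i, p ≤ i → i + 1 < p + n → f (R i) = R' i) →
      f (asym q R p n) = asym q R' p n
  | 0, _ => by simp [asym]
  | 1, _ => by simp [asym]
  | k + 2, h => by
    have ih : f (asym q R p (k + 1)) = asym q R' p (k + 1) :=
      map_asym f (k + 1) fun i hi hk => h i hi (by omega)
    simp [asym_succ_succ, ih, h (p + k) (by omega) (by omega)]

/-- One step of the recursion preserves the absorption property of antisymmetrizers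
(left version). -/
theorem mul_antisymmetrizer_step {q : K} (hq : q ≠ 0) {a b B C : E} {k : ℕ}
    (hab : a * b * a = b * a * b) (hb : b * b = 1 + (q - q⁻¹) • b) (hBb : B * b = b * B)
    (hBC : B * C = C) (hCC : C * C = C) (haC : a * C = -q⁻¹ • C)
    (hC : qInt q (k + 1) • C = B * (q ^ k • (1 : E) - qInt q k • a) * B) :
    b * (C * (q ^ (k + 1) • (1 : E) - qInt q (k + 1) • b) * C) =
      -q⁻¹ • (C * (q ^ (k + 1) • (1 : E) - qInt q (k + 1) • b) * C) := by
  have hbB (X : E) : B * (b * X) = b * (B * X) := by rw [← mul_assoc, hBb, mul_assoc]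
  have hbb (X : E) : b * (b * X) = X + (q - q⁻¹) • (b * X) := by
    rw [← mul_assoc, hb, add_mul, one_mul, smul_mul_assoc]
  have hba : b * (a * (b * C)) = -q⁻¹ • (a * (b * C)) := by
    rw [← mul_assoc, ← mul_assoc, ← hab, mul_assoc, haC, mul_smul_comm, mul_assoc]
  have hBB : B * (B * (b * C)) = b * C := by simp only [hbB, hBC]
  have hE : C * (q ^ (k + 1) • (1 : E) - qInt q (k + 1) • b) * C =
      q ^ (k + 1) • C - q ^ k • (b * C) + qInt q k • (B * (a * (b * C))) := by
    have : qInt q (k + 1) • (C * (b * C)) =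
        q ^ k • (b * C) - qInt q k • (B * (a * (b * C))) := by
      rw [← smul_mul_assoc, hC]
      simp only [mul_sub, sub_mul, mul_assoc, mul_smul_comm, smul_mul_assoc, mul_one, hbB, hBC]
    simp only [mul_sub, sub_mul, mul_assoc, mul_smul_comm, smul_mul_assoc, mul_one, hCC, this]
    abel
  rw [hE]
  simp only [mul_add, mul_sub, mul_smul_comm, hbb, ← hbB, hba, smul_add, smul_sub]
  have h1 : q⁻¹ * q ^ (k + 1) = q ^ k := by
    rw [pow_succ', ← mul_assoc, inv_mul_cancel₀ hq, one_mul]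
  match_scalars
  · ring
  · linear_combination h1
  · ring

/-- One step of the recursion preserves the absorption property of antisymmetrizers
(right version). -/
theorem antisymmetrizer_step_mul {q : K} (hq : q ≠ 0) {a b B C : E} {k : ℕ}
    (hab : a * b * a = b * a * b) (hb : b * b = 1 + (q - q⁻¹) • b) (hBb : B * b = b * B)
    (hBC : C * B = C) (hCC : C * C = C) (haC : C * a = -q⁻¹ • C)
    (hC : qInt q (k + 1) • C = B * (q ^ k • (1 : E) - qInt q k • a) * B) :
    (C * (q ^ (k + 1) • (1 : E) - qInt q (k + 1) • b) * C) * b =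
      -q⁻¹ • (C * (q ^ (k + 1) • (1 : E) - qInt q (k + 1) • b) * C) := by
  open MulOpposite in
  apply op_injective
  have := mul_antisymmetrizer_step (E := Eᵐᵒᵖ) hq (a := op a) (b := op b) (B := op B) (C := op C)
    (k := k) (by simp only [← op_mul, ← mul_assoc, hab]) (by simp only [← op_mul, hb]; simp)
    (by simp only [← op_mul, hBb]) (by simp only [← op_mul, hBC]) (by simp only [← op_mul, hCC])
    (by simp only [← op_mul, haC]; simp)
    (by rw [← op_smul, hC]; simp only [op_mul, op_sub, op_smul, op_one, mul_assoc])
  simpa only [op_mul, op_sub, op_smul, op_one, mul_assoc] using this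

/-- `X` is annihilated from both sides by `R i + q⁻¹` for `p ≤ i < p + n - 1`. -/
def IsAntisymmetric (q : K) (R : ℕ → E) (p n : ℕ) (X : E) : Prop :=
  ∀ i, p ≤ i → i + 1 < p + n → R i * X = -q⁻¹ • X ∧ X * R i = -q⁻¹ • X

variable {q : K} {R : ℕ → E} {L : ℕ}

theorem asym_mul_of_isAntisymmetric (hq : q ≠ 0) (hqn : ∀ n, 1 ≤ n → qInt q n ≠ 0)
    (hq1 : q - q⁻¹ ≠ 0) {p : ℕ} {X : E} :
    ∀ n, IsAntisymmetric q R p n X → asym q R p n * X = X ∧ X * asym q R p n = X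
  | 0, _ => by simp [asym]
  | 1, _ => by simp [asym]
  | k + 2, h => by
    obtain ⟨h1, h2⟩ := asym_mul_of_isAntisymmetric hq hqn hq1 (k + 1)
      fun i hi hk => h i hi (by omega)
    obtain ⟨h3, h4⟩ := h (p + k) (by omega) (by omega)
    have hs : q ^ (k + 1) + qInt q (k + 1) * q⁻¹ = qInt q (k + 2) := by
      rw [show k + 2 = 1 + (k + 1) by ring, qInt_add hq 1 (k + 1), qInt_one hq1]; ring
    rw [asym_succ_succ]
    constructor
    · rw [smul_mul_assoc, mul_assoc, h1, mul_assoc, sub_mul, smul_mul_assoc, smul_mul_assoc, h3,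
        one_mul, smul_smul, ← sub_smul, mul_smul_comm, h1, smul_smul, mul_neg, sub_neg_eq_add, hs,
        inv_mul_cancel₀ (hqn _ (by omega)), one_smul]
    · rw [mul_smul_comm, ← mul_assoc, ← mul_assoc, h2, mul_sub, mul_smul_comm, mul_smul_comm, h4,
        mul_one, smul_smul, ← sub_smul, smul_mul_assoc, h2, smul_smul, mul_neg, sub_neg_eq_add, hs,
        inv_mul_cancel₀ (hqn _ (by omega)), one_smul]

theorem isAntisymmetric_asym (hq : q ≠ 0) (hqn : ∀ n, 1 ≤ n → qInt q n ≠ 0)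
    (hq1 : q - q⁻¹ ≠ 0) (hR : IsHeckeSeq q R L) (p : ℕ) :
    ∀ n, p + n ≤ L + 1 → IsAntisymmetric q R p n (asym q R p n)
  | 0, _ => fun i _ _ => by omega
  | 1, _ => fun i _ _ => by omega
  | 2, hL => fun i hi hn => by
    obtain rfl : i = p := by omega
    rw [asym_succ_succ]
    have h1 : q⁻¹ * q = 1 := inv_mul_cancel₀ hq
    constructor
    all_goals
      simp only [asym, zero_add, pow_one, qInt_one hq1, one_mul, mul_one, one_smul, add_zero,
        mul_smul_comm, smul_mul_assoc, mul_sub, sub_mul, hR.quad i (by omega)]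
      rw [smul_comm (-q⁻¹)]
      congr 1
      match_scalars
      · ring1
      · linear_combination h1
  | k + 3, hL => by
    have ih1 := isAntisymmetric_asym hq hqn hq1 hR p (k + 1) (by omega)
    have ih2 := isAntisymmetric_asym hq hqn hq1 hR p (k + 2) (by omega)
    have hCC := (asym_mul_of_isAntisymmetric hq hqn hq1 _ ih2).1
    obtain ⟨hBC, hCB⟩ := asym_mul_of_isAntisymmetric hq hqn hq1 (k + 1)
      (fun i hi hk => ih2 i hi (by omega))
    have hBb : asym q R p (k + 1) * R (p + (k + 1)) = R (p + (k + 1)) * asym q R p (k + 1) :=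
      (commute_asym fun i hi hk => (hR.far i _ (by omega) (by omega)).symm).eq.symm
    have hC : qInt q (k + 1 + 1) • asym q R p (k + 2) = asym q R p (k + 1) *
        (q ^ (k + 1) • (1 : E) - qInt q (k + 1) • R (p + k)) * asym q R p (k + 1) := by
      rw [asym_succ_succ, smul_inv_smul₀ (hqn _ (by omega))]
    intro i hi hn
    rw [asym_succ_succ, mul_smul_comm, smul_mul_assoc, smul_comm (-q⁻¹)]
    rcases Nat.lt_or_ge i (p + (k + 1)) with h | h
    · obtain ⟨h1, h2⟩ := ih2 i hi (by omega)
      constructor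
      · rw [← mul_assoc, ← mul_assoc, h1, smul_mul_assoc, smul_mul_assoc]
      · rw [mul_assoc _ _ (R i), h2, mul_smul_comm]
    · obtain rfl : i = p + (k + 1) := by omega
      obtain ⟨h1, h2⟩ := ih2 (p + k) (by omega) (by omega)
      have hbr : R (p + k) * R (p + (k + 1)) * R (p + k) =
          R (p + (k + 1)) * R (p + k) * R (p + (k + 1)) := hR.braid (p + k) (by omega)
      rw [mul_antisymmetrizer_step hq hbr (hR.quad _ (by omega)) hBb hBC
        hCC h1 hC, antisymmetrizer_step_mul hq hbr
        (hR.quad _ (by omega)) hBb hCB hCC h2 hC]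
      exact ⟨rfl, rfl⟩

theorem asym_mul_self (hq : q ≠ 0) (hqn : ∀ n, 1 ≤ n → qInt q n ≠ 0)
    (hq1 : q - q⁻¹ ≠ 0) (hR : IsHeckeSeq q R L) (p n : ℕ) (h : p + n ≤ L + 1) :
    asym q R p n * asym q R p n = asym q R p n :=
  (asym_mul_of_isAntisymmetric hq hqn hq1 _ (isAntisymmetric_asym hq hqn hq1 hR p n h)).1

/-- The recursion for antisymmetrizers which adds a generator on the left. -/
theorem asym_succ_succ_left (hq : q ≠ 0) (hqn : ∀ n, 1 ≤ n → qInt q n ≠ 0)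
    (hq1 : q - q⁻¹ ≠ 0) (hR : IsHeckeSeq q R L) : ∀ (k p : ℕ), p + (k + 2) ≤ L + 1 →
    qInt q (k + 2) • asym q R p (k + 2) = asym q R (p + 1) (k + 1) *
      (q ^ (k + 1) • (1 : E) - qInt q (k + 1) • R p) * asym q R (p + 1) (k + 1)
  | 0, p, hL => by
    rw [asym_succ_succ, smul_inv_smul₀ (hqn _ (by omega))]
    simp [asym]
  | k + 1, p, hL => by
    have ih2 := isAntisymmetric_asym hq hqn hq1 hR (p + 1) (k + 2) (by omega)
    set X : E := asym q R (p + 1) (k + 2) *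
      (q ^ (k + 2) • (1 : E) - qInt q (k + 2) • R p) * asym q R (p + 1) (k + 2) with hX
    have hCC := asym_mul_self hq hqn hq1 hR (p + 1) (k + 2) (by omega)
    have hXa : IsAntisymmetric q R p (k + 3) X := by
      intro i hi hn
      rcases Nat.lt_or_ge p i with h | h
      · obtain ⟨h1, h2⟩ := ih2 i (by omega) (by omega)
        constructor
        · rw [hX, ← mul_assoc, ← mul_assoc, h1, smul_mul_assoc, smul_mul_assoc]
        · rw [hX, mul_assoc _ _ (R i), h2, mul_smul_comm]
      · obtain rfl : i = p := by omega
        obtain ⟨h1, h2⟩ := ih2 (i + 1) (by omega) (by omega)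
        obtain ⟨hBC, hCB⟩ := asym_mul_of_isAntisymmetric (p := i + 2) hq hqn hq1 (k + 1)
          (fun j hj hk => ih2 j (by omega) (by omega))
        have hBb : asym q R (i + 2) (k + 1) * R i = R i * asym q R (i + 2) (k + 1) :=
          (commute_asym fun j hj hk => (hR.far i _ (by omega) (by omega))).eq.symm
        have hC := asym_succ_succ_left hq hqn hq1 hR k (i + 1) (by omega)
        exact ⟨mul_antisymmetrizer_step hq (hR.braid i (by omega)).symm (hR.quad _ (by omega)) hBb
          hBC hCC h1 hC, antisymmetrizer_step_mul hq (hR.braid i (by omega)).symm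
          (hR.quad _ (by omega)) hBb hCB hCC h2 hC⟩
    have hA := isAntisymmetric_asym hq hqn hq1 hR p (k + 3) hL
    obtain ⟨h1, h2⟩ := asym_mul_of_isAntisymmetric (p := p + 1) hq hqn hq1 (k + 2)
      (fun i hi hn => hA i (by omega) (by omega))
    have hXA := (asym_mul_of_isAntisymmetric hq hqn hq1 _ hXa).1
    have hAR := (hA p le_rfl (by omega)).2
    rw [← hXA, hX, ← mul_assoc, ← mul_assoc, h2, mul_sub, mul_smul_comm, mul_smul_comm, mul_one,
      hAR, smul_smul, ← sub_smul, smul_mul_assoc, h2]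
    congr 1
    rw [show k + 1 + 2 = 1 + (k + 2) by ring, qInt_add hq 1 (k + 2), qInt_one hq1]
    ring

end Hecke

/-! ### Cyclic functionals on a quotient of a Hecke algebra -/

section Cyclic

variable {K : Type*} [Field K] {E : Type*} [Ring E] [Algebra K E]
  {P : Type*} [AddCommGroup P] [Module K P]

/-- The elements with respect to which a linear map is cyclic. -/
def cyclicSubalgebra (φ : E →ₗ[K] P) : Subalgebra K E where
  carrier := {Y | ∀ X, φ (Y * X) = φ (X * Y)}
  mul_mem' {a b} ha hb X := by rw [mul_assoc, ha, mul_assoc, hb, mul_assoc]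
  add_mem' {a b} ha hb X := by rw [add_mul, mul_add, map_add, map_add, ha, hb]
  algebraMap_mem' r X := by rw [Algebra.commutes]

theorem mem_cyclicSubalgebra {φ : E →ₗ[K] P} {Y : E} :
    Y ∈ cyclicSubalgebra φ ↔ ∀ X, φ (Y * X) = φ (X * Y) := Iff.rfl

/-- The product `R p ⋯ R (p + l - 1)`. -/
def ascProd (R : ℕ → E) (p : ℕ) : ℕ → E
  | 0 => 1
  | l + 1 => ascProd R p l * R (p + l)

theorem ascProd_succ_left (R : ℕ → E) (p : ℕ) :
    ∀ l, ascProd R p (l + 1) = R p * ascProd R (p + 1) l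
  | 0 => by simp [ascProd]
  | l + 1 => by
    rw [ascProd, ascProd_succ_left R p l, ascProd, mul_assoc, show p + (l + 1) = p + 1 + l by ring]

variable {q : K} {R : ℕ → E} {L : ℕ}

theorem IsHeckeSeq.neg_inv (hR : IsHeckeSeq q R L) : IsHeckeSeq (-q⁻¹) R L :=
  ⟨fun i hi => by rw [neg_inv_sub_inv]; exact hR.quad i hi, hR.braid, hR.far⟩

theorem qInt_neg_inv_ne_zero (hqn : ∀ n, 1 ≤ n → qInt q n ≠ 0) :
    ∀ n, 1 ≤ n → qInt (-q⁻¹) n ≠ 0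
  | n + 1, _ => by
    rw [qInt_neg_inv]
    exact mul_ne_zero (pow_ne_zero _ (neg_ne_zero.2 one_ne_zero)) (hqn _ (by omega))

theorem qInt_smul_asym_succ (hqn : ∀ n, 1 ≤ n → qInt q n ≠ 0) (hq1 : q - q⁻¹ ≠ 0) (p : ℕ) :
    ∀ n, qInt q (n + 1) • asym q R p (n + 1) =
      asym q R p n * (q ^ n • (1 : E) - qInt q n • R (p + n - 1)) * asym q R p n
  | 0 => by simp [asym, qInt_zero, qInt_one hq1]
  | n + 1 => by rw [asym_succ_succ, smul_inv_smul₀ (hqn _ (by omega))]; rfl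

theorem qInt_smul_asym_succ_left (hq : q ≠ 0) (hqn : ∀ n, 1 ≤ n → qInt q n ≠ 0)
    (hq1 : q - q⁻¹ ≠ 0) (hR : IsHeckeSeq q R L) (p : ℕ) :
    ∀ n, p + n ≤ L → qInt q (n + 1) • asym q R p (n + 1) =
      asym q R (p + 1) n * (q ^ n • (1 : E) - qInt q n • R p) * asym q R (p + 1) n
  | 0, _ => by simp [asym, qInt_zero, qInt_one hq1]
  | n + 1, h => asym_succ_succ_left hq hqn hq1 hR n p (by omega)

theorem commute_asym_asym (hR : IsHeckeSeq q R L) (q₁ q₂ : K) {p n p' n' : ℕ} (h : p + n ≤ p')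
    (h' : p' + n' ≤ L + 1) : Commute (asym q₁ R p n) (asym q₂ R p' n') :=
  commute_asym fun i hi hn => (commute_asym fun k hk hkn =>
    (hR.far k i (by omega) (by omega)).symm).symm

theorem asym_mem_cyclic {φ : E →ₗ[K] P} {s n : ℕ}
    (hφ : ∀ i, s ≤ i → i + 1 < s + n → R i ∈ cyclicSubalgebra φ) (q : K) (p l : ℕ)
    (hp : s ≤ p) (hl : p + l ≤ s + n) : asym q R p l ∈ cyclicSubalgebra φ :=
  asym_mem _ _ fun i hi hn => hφ i (by omega) (by omega)

/-- The Wronski relations between symmetrizers and antisymmetrizers under a cyclic functional. -/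
theorem sum_asym_mul_sym_eq_zero (hq : q ≠ 0) (hqn : ∀ n, 1 ≤ n → qInt q n ≠ 0)
    (hq1 : q - q⁻¹ ≠ 0) (hR : IsHeckeSeq q R L) (φ : E →ₗ[K] P) {s n : ℕ} (hn : 1 ≤ n)
    (hL : s + n ≤ L + 1)
    (hφ : ∀ i, s ≤ i → i + 1 < s + n → R i ∈ cyclicSubalgebra φ) :
    ∑ i ∈ Finset.range (n + 1),
      (-1 : K) ^ i • φ (asym q R s i * asym (-q⁻¹) R (s + i) (n - i)) = 0 := by
  have hq' : -q⁻¹ ≠ 0 := neg_ne_zero.2 (inv_ne_zero hq)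
  have hqn' := qInt_neg_inv_ne_zero hqn
  have hq1' : -q⁻¹ - (-q⁻¹)⁻¹ ≠ 0 := by rwa [neg_inv_sub_inv]
  set z : ℕ → P := fun i => (qInt q i * qInt (-q⁻¹) (n + 1 - i)) •
    φ (asym q R s i * asym (-q⁻¹) R (s + i - 1) (n + 1 - i)) with hz
  have key : ∀ i ∈ Finset.range (n + 1), z (i + 1) - z i = (-(-1) ^ n * qInt q n) •
      ((-1 : K) ^ i • φ (asym q R s i * asym (-q⁻¹) R (s + i) (n - i))) := by
    intro i hi
    rw [Finset.mem_range] at hi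
    have hcomm := (commute_asym_asym hR q (-q⁻¹) (le_refl (s + i))
      (show s + i + (n - i) ≤ L + 1 by omega)).eq
    have e1 : qInt q (i + 1) • φ (asym q R s (i + 1) * asym (-q⁻¹) R (s + i) (n - i)) =
        q ^ i • φ (asym q R s i * asym (-q⁻¹) R (s + i) (n - i)) -
        qInt q i • φ (asym q R s i * R (s + i - 1) * asym (-q⁻¹) R (s + i) (n - i)) := by
      rw [← map_smul, ← smul_mul_assoc, qInt_smul_asym_succ hqn hq1, mul_assoc, hcomm, ← mul_assoc,
        ← mem_cyclicSubalgebra.1 (asym_mem_cyclic hφ q s i le_rfl (by omega)), ← mul_assoc,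
        ← mul_assoc, asym_mul_self hq hqn hq1 hR _ _ (by omega)]
      simp only [mul_sub, sub_mul, mul_smul_comm, smul_mul_assoc, mul_one, map_sub, map_smul, hcomm]
    have e2 : qInt q i • qInt (-q⁻¹) (n + 1 - i) •
          φ (asym q R s i * asym (-q⁻¹) R (s + i - 1) (n + 1 - i)) =
        qInt q i • ((-q⁻¹) ^ (n - i) • φ (asym q R s i * asym (-q⁻¹) R (s + i) (n - i)) -
        qInt (-q⁻¹) (n - i) •
          φ (asym q R s i * R (s + i - 1) * asym (-q⁻¹) R (s + i) (n - i))) := by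
      rcases Nat.eq_zero_or_pos i with rfl | hi0
      · simp [qInt_zero]
      congr 1
      rw [show n + 1 - i = n - i + 1 by omega, ← map_smul, ← mul_smul_comm,
        qInt_smul_asym_succ_left hq' hqn' hq1' hR.neg_inv _ _ (by omega),
        show s + i - 1 + 1 = s + i by omega, ← mul_assoc, ← mul_assoc, hcomm, mul_assoc, mul_assoc,
        mem_cyclicSubalgebra.1 (asym_mem_cyclic hφ (-q⁻¹) (s + i) (n - i) (by omega) (by omega)),
        mul_assoc, mul_assoc, asym_mul_self hq' hqn' hq1' hR.neg_inv _ _ (by omega)]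
      simp only [mul_sub, sub_mul, mul_smul_comm, smul_mul_assoc, one_mul, map_sub, map_smul,
        mul_assoc, hcomm]
    have h3 : qInt (-q⁻¹) (n - i) * q ^ i - qInt q i * (-q⁻¹) ^ (n - i) =
        -(-1) ^ n * qInt q n * (-1) ^ i := by
      obtain ⟨l, rfl⟩ : ∃ l, n = l + i := ⟨n - i, by omega⟩
      have h1 : ((-1 : K) ^ i) * (-1) ^ i = 1 := by rw [← mul_pow]; simp
      rw [Nat.add_sub_cancel, qInt_add hq, neg_pow q⁻¹, pow_add (-1 : K)]
      cases l with
      | zero =>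
        simp only [qInt_zero, pow_zero]
        linear_combination (qInt q i) * h1
      | succ l =>
        rw [qInt_neg_inv, pow_succ (-1 : K) l]
        linear_combination
          (-(-1) ^ l * (q ^ i * qInt q (l + 1) + q⁻¹ ^ (l + 1) * qInt q i)) * h1
    have h4 : z (i + 1) - z i = (qInt (-q⁻¹) (n - i) * q ^ i - qInt q i * (-q⁻¹) ^ (n - i)) •
        φ (asym q R s i * asym (-q⁻¹) R (s + i) (n - i)) := by
      simp only [hz]
      rw [show n + 1 - (i + 1) = n - i by omega, show s + (i + 1) - 1 = s + i by omega,
        mul_comm, mul_smul, e1, mul_smul, e2]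
      module
    rw [h4, h3, mul_smul]
  have h0 := Finset.sum_range_sub z (n + 1)
  rw [Finset.sum_congr rfl key, ← Finset.smul_sum] at h0
  have hz0 : z 0 = 0 := by simp [hz, qInt_zero]
  have hzn : z (n + 1) = 0 := by simp [hz, qInt_zero]
  rw [hz0, hzn, sub_zero] at h0
  refine (smul_eq_zero.1 h0).resolve_left (mul_ne_zero ?_ (hqn n hn))
  exact neg_ne_zero.2 (pow_ne_zero _ (neg_ne_zero.2 one_ne_zero))

/-- The expansion of a Coxeter-type element under a functional which is cyclic with respect to
all generators but the first one. -/
theorem map_ascProd_eq_sum (hq : q ≠ 0) (hqn : ∀ n, 1 ≤ n → qInt q n ≠ 0)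
    (hq1 : q - q⁻¹ ≠ 0) (hR : IsHeckeSeq q R L) : ∀ (j s : ℕ) (φ : E →ₗ[K] P), s + j ≤ L →
    (∀ i, s < i → i < s + j → R i ∈ cyclicSubalgebra φ) →
    φ (ascProd R s j) = ∑ i ∈ Finset.range (j + 1), ((-1 : K) ^ i * q ^ (j - i) * qInt q (i + 1)) •
      φ (asym q R s (i + 1) * asym (-q⁻¹) R (s + i + 1) (j - i))
  | 0, s, φ, _, _ => by simp [ascProd, asym, qInt_one hq1]
  | j + 1, s, φ, hL, hφ => by
    have hφ' : ∀ i, s + 1 ≤ i → i + 1 < s + 1 + (j + 1) → R i ∈ cyclicSubalgebra φ :=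
      fun i hi hj => hφ i (by omega) (by omega)
    set u : ℕ → E := fun i => asym q R (s + 1) i * asym (-q⁻¹) R (s + 1 + i) (j + 1 - i) with hu
    have e1 : ∀ i ∈ Finset.range (j + 2), ((-1 : K) ^ i * q ^ (j + 1 - i) * qInt q (i + 1)) •
        φ (asym q R s (i + 1) * asym (-q⁻¹) R (s + i + 1) (j + 1 - i)) =
        q ^ (j + 1) • ((-1 : K) ^ i • φ (u i)) -
          ((-1 : K) ^ i * q ^ (j + 1 - i) * qInt q i) • φ (R s * u i) := by
      intro i hi
      rw [Finset.mem_range] at hi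
      have hcomm := (commute_asym_asym hR q (-q⁻¹) (le_refl (s + 1 + i))
        (show s + 1 + i + (j + 1 - i) ≤ L + 1 by omega)).eq
      rw [mul_smul, ← map_smul, ← smul_mul_assoc,
        qInt_smul_asym_succ_left hq hqn hq1 hR s i (by omega), show s + i + 1 = s + 1 + i by ring,
        mul_assoc, mul_assoc,
        mem_cyclicSubalgebra.1 (asym_mem_cyclic hφ' q (s + 1) i le_rfl (by omega)), mul_assoc,
        mul_assoc, ← hcomm, ← mul_assoc (asym _ _ _ _), asym_mul_self hq hqn hq1 hR _ _ (by omega)]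
      have : q ^ (j + 1) = q ^ (j + 1 - i) * q ^ i := by rw [← pow_add]; congr 1; omega
      rw [this]
      simp only [sub_mul, smul_mul_assoc, one_mul, map_sub, map_smul]
      module
    have hW := sum_asym_mul_sym_eq_zero hq hqn hq1 hR φ (s := s + 1) (n := j + 1) (by omega)
      (by omega) hφ'
    have ih := map_ascProd_eq_sum hq hqn hq1 hR j (s + 1) (φ ∘ₗ LinearMap.mulLeft K (R s))
      (by omega) fun i hi hj X => by
        have h1 : R s * R i = R i * R s := hR.far s i (by omega) (by omega)
        simp only [LinearMap.comp_apply, LinearMap.mulLeft_apply]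
        rw [← mul_assoc, h1, mul_assoc, mem_cyclicSubalgebra.1 (hφ i (by omega) (by omega)),
          mul_assoc]
    simp only [LinearMap.comp_apply, LinearMap.mulLeft_apply] at ih
    rw [Finset.sum_congr rfl e1, Finset.sum_sub_distrib, ← Finset.smul_sum, hW, smul_zero, zero_sub,
      Finset.sum_range_succ', ascProd_succ_left, ih, qInt_zero, mul_zero, zero_smul, add_zero,
      ← Finset.sum_neg_distrib]
    refine Finset.sum_congr rfl fun i hi => ?_
    simp only [hu]
    rw [← neg_smul, show j + 1 - (i + 1) = j - i by omega, pow_succ (-1 : K) i]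
    congr 1
    ring

end Cyclic

section Sites

open Matrix Kronecker

/-! ### Traces over a matrix subalgebra -/

section FullTrace

variable {K : Type*} [Field K] {E : Type*} [Ring E] [Algebra K E]
  {n : Type*} [Fintype n] [DecidableEq n]

/-- The trace over a subalgebra of matrices, with values in its centralizer. -/
noncomputable def subTrace (f : Matrix n n K →ₐ[K] E) : E →ₗ[K] E :=
  ∑ x, ∑ v, LinearMap.mulLeft K (f (single x v 1)) ∘ₗ LinearMap.mulRight K (f (single v x 1))

variable (f : Matrix n n K →ₐ[K] E)

theorem subTrace_apply (Y : E) :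
    subTrace f Y = ∑ x, ∑ v, f (single x v 1) * Y * f (single v x 1) := by
  simp [subTrace, LinearMap.sum_apply, mul_assoc]

theorem map_eq_sum_single (X : Matrix n n K) :
    f X = ∑ a, ∑ b, X a b • f (single a b 1) := by
  conv_lhs => rw [matrix_eq_sum_single X]
  simp only [map_sum, ← map_smul, smul_single, smul_eq_mul, mul_one]

theorem map_single_mul_map_single (a b c d : n) :
    f (single a b 1) * f (single c d 1) = if b = c then f (single a d 1) else 0 := by
  rw [← map_mul]
  split_ifs with h
  · subst h; simp
  · simp [h]

theorem sum_map_single : ∑ x, f (single x x 1) = 1 := by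
  rw [← map_sum, sum_single_one, map_one]

theorem subTrace_mul_comm (Y : E) (X : Matrix n n K) :
    subTrace f (Y * f X) = subTrace f (f X * Y) := by
  simp only [subTrace_apply, map_eq_sum_single f X, Finset.mul_sum, Finset.sum_mul, mul_smul_comm,
    smul_mul_assoc, mul_assoc, map_single_mul_map_single]
  simp only [← mul_assoc, map_single_mul_map_single]
  simp only [ite_mul, mul_ite, zero_mul, mul_zero, smul_ite, smul_zero,
    Finset.sum_ite_eq', Finset.mem_univ, if_true]
  refine Finset.sum_congr rfl fun x _ => ?_
  rw [Finset.sum_comm]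
  refine Finset.sum_congr rfl fun y _ => ?_
  rw [Finset.sum_comm]
  simp

theorem commute_subTrace_map (Y : E) (X : Matrix n n K) : Commute (subTrace f Y) (f X) := by
  rw [map_eq_sum_single f X]
  refine Commute.sum_right _ _ _ fun a _ => Commute.sum_right _ _ _ fun b _ =>
    Commute.smul_right ?_ _
  rw [commute_iff_eq, subTrace_apply]
  simp only [Finset.mul_sum, Finset.sum_mul, mul_assoc, map_single_mul_map_single]
  simp only [← mul_assoc, map_single_mul_map_single]
  simp

theorem subTrace_mul_left {Z : E} (h : ∀ X, Commute Z (f X)) (Y : E) :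
    subTrace f (Z * Y) = Z * subTrace f Y := by
  simp only [subTrace_apply, Finset.mul_sum]
  refine Finset.sum_congr rfl fun x _ => Finset.sum_congr rfl fun v _ => ?_
  rw [← mul_assoc, ← mul_assoc, ← mul_assoc, (h _).eq]

theorem subTrace_mul_right {Z : E} (h : ∀ X, Commute Z (f X)) (Y : E) :
    subTrace f (Y * Z) = subTrace f Y * Z := by
  simp only [subTrace_apply, Finset.sum_mul]
  refine Finset.sum_congr rfl fun x _ => Finset.sum_congr rfl fun v _ => ?_
  rw [mul_assoc, mul_assoc, (h _).eq, mul_assoc, mul_assoc]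

theorem commute_subTrace {Z Y : E} (h : ∀ X, Commute Z (f X)) (hY : Commute Z Y) :
    Commute Z (subTrace f Y) := by
  rw [commute_iff_eq, ← subTrace_mul_left f h, hY.eq, subTrace_mul_right f h]

theorem subTrace_map (X : Matrix n n K) : subTrace f (f X) = X.trace • 1 := by
  rw [subTrace_apply]
  simp only [map_eq_sum_single f X, Finset.mul_sum, Finset.sum_mul, mul_smul_comm,
    smul_mul_assoc, map_single_mul_map_single]
  simp [map_single_mul_map_single, trace, Finset.sum_smul, ← sum_map_single f, Finset.smul_sum]

theorem sum_map_single_mul_subTrace (Y : E) :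
    ∑ a, ∑ b, f (single a b 1) * subTrace f (f (single b a 1) * Y) = Y := by
  simp only [subTrace_apply, Finset.mul_sum, ← mul_assoc, map_single_mul_map_single]
  simp [mul_assoc, map_single_mul_map_single, ← Finset.mul_sum, ← Finset.sum_mul, sum_map_single]

end FullTrace

theorem sum_comm_pairs {α β γ δ P : Type*} [Fintype α] [Fintype β] [Fintype γ] [Fintype δ]
    [AddCommMonoid P] (f : α → β → γ → δ → P) :
    ∑ a, ∑ b, ∑ c, ∑ d, f a b c d = ∑ c, ∑ d, ∑ a, ∑ b, f a b c d := by
  have := Finset.sum_comm (s := (Finset.univ : Finset (α × β)))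
    (t := (Finset.univ : Finset (γ × δ))) (f := fun p r => f p.1 p.2 r.1 r.2)
  simpa only [Fintype.sum_prod_type] using this

/-! ### Systems of commuting matrix subalgebras -/

section SiteSystem

variable {K : Type*} [Field K] {N : ℕ} {E : Type*} [Ring E] [Algebra K E]

variable (K N E) in
/-- An abstract version of the action of one-site and two-site operators on `V^{⊗m}`. -/
structure SiteSystem (m : ℕ) where
  one : ℕ → Matrix (Fin N) (Fin N) K →ₐ[K] E
  two : ℕ → M2 N K →ₐ[K] E
  two_left : ∀ i, i + 1 < m → ∀ X, two i (X ⊗ₖ 1) = one i X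
  two_right : ∀ i, i + 1 < m → ∀ X, two i (1 ⊗ₖ X) = one (i + 1) X
  comm : ∀ i j, i + 1 < j → j < m → ∀ X Y, Commute (one i X) (one j Y)

namespace SiteSystem

variable {m : ℕ} (S : SiteSystem K N E m) {i j : ℕ}

theorem two_kronecker (hi : i + 1 < m) (X Y : Matrix (Fin N) (Fin N) K) :
    S.two i (X ⊗ₖ Y) = S.one i X * S.one (i + 1) Y := by
  rw [← S.two_left i hi, ← S.two_right i hi, ← map_mul, ← mul_kronecker_mul, mul_one, one_mul]

theorem two_single (hi : i + 1 < m) (a b c d : Fin N) : S.two i (single (a, b) (c, d) 1) =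
    S.one i (single a c 1) * S.one (i + 1) (single b d 1) := by
  rw [← S.two_kronecker hi, single_kronecker_single, mul_one]

theorem two_eq_sum (hi : i + 1 < m) (X : M2 N K) : S.two i X =
    ∑ p, ∑ r, X p r • (S.one i (single p.1 r.1 1) * S.one (i + 1) (single p.2 r.2 1)) := by
  rw [map_eq_sum_single]
  simp only [← S.two_single hi]

theorem commute_one_succ (hi : i + 1 < m) (X Y : Matrix (Fin N) (Fin N) K) :
    Commute (S.one i X) (S.one (i + 1) Y) := by
  rw [commute_iff_eq, ← S.two_left i hi, ← S.two_right i hi, ← map_mul, ← map_mul,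
    ← mul_kronecker_mul, ← mul_kronecker_mul]
  simp

theorem commute_one (hij : i ≠ j) (hi : i < m) (hj : j < m) (X Y : Matrix (Fin N) (Fin N) K) :
    Commute (S.one i X) (S.one j Y) := by
  rcases lt_trichotomy i j with h | h | h
  · rcases eq_or_lt_of_le (Nat.succ_le_of_lt h) with h' | h'
    · subst h'; exact S.commute_one_succ hj X Y
    · exact S.comm i j h' hj X Y
  · exact absurd h hij
  · rcases eq_or_lt_of_le (Nat.succ_le_of_lt h) with h' | h'
    · subst h'; exact (S.commute_one_succ hi Y X).symm
    · exact (S.comm j i h' hi Y X).symm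

theorem commute_two {Z : E} (hi : i + 1 < m) (h : ∀ X, Commute Z (S.one i X))
    (h' : ∀ X, Commute Z (S.one (i + 1) X)) (X : M2 N K) : Commute Z (S.two i X) := by
  rw [S.two_eq_sum hi]
  exact Commute.sum_right _ _ _ fun a _ => Commute.sum_right _ _ _ fun b _ =>
    Commute.smul_right ((h _).mul_right (h' _)) _

theorem commute_two_one (hi : i + 1 < m) (hj : j < m) (h : j ≠ i) (h' : j ≠ i + 1) (X : M2 N K)
    (Y : Matrix (Fin N) (Fin N) K) : Commute (S.two i X) (S.one j Y) :=
  (S.commute_two hi (fun _ => S.commute_one h hj (by omega) _ _)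
    (fun _ => S.commute_one h' hj hi _ _) X).symm

theorem commute_two_two (hij : i + 1 < j) (hj : j + 1 < m) (X Y : M2 N K) :
    Commute (S.two i X) (S.two j Y) :=
  S.commute_two hj (fun _ => S.commute_two_one (by omega) (by omega) (by omega) (by omega) _ _)
    (fun _ => S.commute_two_one (by omega) (by omega) (by omega) (by omega) _ _) Y

variable (D : Matrix (Fin N) (Fin N) K)

/-- The quantum trace over the `i`-th site. -/
noncomputable def qtrace (i : ℕ) : E →ₗ[K] E :=
  subTrace (S.one i) ∘ₗ LinearMap.mulLeft K (S.one i D)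

theorem qtrace_apply (i : ℕ) (Y : E) : S.qtrace D i Y = subTrace (S.one i) (S.one i D * Y) := rfl

variable {D}

theorem qtrace_mul_left {Z : E} (h : ∀ X, Commute Z (S.one i X)) (Y : E) :
    S.qtrace D i (Z * Y) = Z * S.qtrace D i Y := by
  rw [qtrace_apply, ← mul_assoc, ← (h D).eq, mul_assoc, subTrace_mul_left _ h, qtrace_apply]

theorem qtrace_mul_right {Z : E} (h : ∀ X, Commute Z (S.one i X)) (Y : E) :
    S.qtrace D i (Y * Z) = S.qtrace D i Y * Z := by
  rw [qtrace_apply, ← mul_assoc, subTrace_mul_right _ h, qtrace_apply]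

theorem commute_qtrace_one (i : ℕ) (Y : E) (X : Matrix (Fin N) (Fin N) K) :
    Commute (S.qtrace D i Y) (S.one i X) := commute_subTrace_map _ _ _

theorem qtrace_one (i : ℕ) (X : Matrix (Fin N) (Fin N) K) :
    S.qtrace D i (S.one i X) = (D * X).trace • 1 := by
  rw [qtrace_apply, ← map_mul, subTrace_map]

theorem subTrace_subTrace (hi : i + 1 < m) (Y : E) :
    subTrace (S.one i) (subTrace (S.one (i + 1)) Y) = subTrace (S.two i) Y := by
  simp only [subTrace_apply, Fintype.sum_prod_type, S.two_single hi, Finset.mul_sum,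
    Finset.sum_mul]
  refine Finset.sum_congr rfl fun x _ => ?_
  rw [Finset.sum_comm]
  refine Finset.sum_congr rfl fun y _ => Finset.sum_congr rfl fun u _ =>
    Finset.sum_congr rfl fun v _ => ?_
  rw [(S.commute_one_succ hi (single u x 1) _).eq]
  simp only [mul_assoc]

theorem qtrace_qtrace (hi : i + 1 < m) (Y : E) :
    S.qtrace D i (S.qtrace D (i + 1) Y) = subTrace (S.two i) (S.two i (D ⊗ₖ D) * Y) := by
  rw [qtrace_apply, qtrace_apply, ← subTrace_mul_left _ (fun X => S.commute_one_succ hi _ _),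
    S.subTrace_subTrace hi, S.two_kronecker hi, mul_assoc]

/-- The quantum trace of a two-site operator over the second site. -/
def _root_.CHN.ptrace (D : Matrix (Fin N) (Fin N) K) (W : M2 N K) : Matrix (Fin N) (Fin N) K :=
  of fun g f => ∑ b, ∑ d, D d b * W (g, b) (f, d)

theorem qtrace_two (hi : i + 1 < m) (W : M2 N K) :
    S.qtrace D (i + 1) (S.two i W) = S.one i (ptrace D W) := by
  rw [S.two_eq_sum hi, map_eq_sum_single]
  simp only [map_sum, map_smul, Fintype.sum_prod_type,
    S.qtrace_mul_left (fun X => S.commute_one_succ hi _ _), qtrace_one, ptrace, of_apply,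
    trace_mul_single, Finset.sum_smul, mul_smul_comm, mul_one]
  simp only [smul_smul, MulOpposite.smul_eq_mul_unop, MulOpposite.unop_op, mul_one, mul_comm]
  refine Finset.sum_congr rfl fun g _ => ?_
  rw [Finset.sum_comm]

variable {F Ψ : M2 N K}

/-- Closedness, with the two matrices exchanged. -/
theorem _root_.CHN.IsClosedPair.exchange (h : IsClosedPair F Ψ) (f g f' g' : Fin N) :
    ∑ b, ∑ d, F (g, b) (f, d) * Ψ (d, f') (b, g') = if f = f' ∧ g = g' then 1 else 0 := by
  set P : M2 N K := of fun p r => Ψ (p.1, r.1) (p.2, r.2) with hP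
  set Q : M2 N K := of fun p r => F (p.2, r.2) (p.1, r.1) with hQ
  have h1 : P * Q = 1 := by
    ext ⟨a, c⟩ ⟨d, b⟩
    simp only [mul_apply, Fintype.sum_prod_type, hP, hQ, of_apply, h a b c d, one_apply,
      Prod.mk.injEq, eq_comm]
  have h2 : Q * P = 1 := mul_eq_one_comm.1 h1
  have h3 := congr_fun (congr_fun h2 (f, g)) (f', g')
  simp only [mul_apply, Fintype.sum_prod_type, hP, hQ, of_apply, one_apply, Prod.mk.injEq] at h3
  rw [← h3, Finset.sum_comm]

theorem _root_.CHN.IsClosedPair.ptrace_eq_one (h : IsClosedPair F Ψ) :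
    ptrace (Dmat Ψ) F = 1 := by
  ext g f
  calc ptrace (Dmat Ψ) F g f = ∑ b, ∑ c, ∑ d, F (g, b) (f, d) * Ψ (d, c) (b, c) := by
        change ∑ b, ∑ d, Dmat Ψ d b * F (g, b) (f, d) = _
        refine Finset.sum_congr rfl fun b _ => ?_
        rw [Finset.sum_comm (γ := Fin N)]
        refine Finset.sum_congr rfl fun d _ => ?_
        simp only [Dmat, mul_comm, Finset.mul_sum]
    _ = ∑ c, ∑ b, ∑ d, F (g, b) (f, d) * Ψ (d, c) (b, c) := Finset.sum_comm
    _ = _ := by simp [h.exchange, one_apply, ite_and]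

/-- A linear map vanishing on the two-sided module generated by `F` vanishes on
all operators on the second site. -/
theorem map_one_succ_eq_zero {P : Type*} [AddCommGroup P] [Module K P] (h : IsClosedPair F Ψ)
    (hi : i + 1 < m) (L : E →ₗ[K] P)
    (hL : ∀ X Y, L (S.one i X * S.two i F * S.one i Y) = 0) (Z : Matrix (Fin N) (Fin N) K) :
    L (S.one (i + 1) Z) = 0 := by
  have h1 : ∀ g f, ∑ b, ∑ d, F (g, b) (f, d) • L (S.one (i + 1) (single b d 1)) = 0 := by
    intro g f
    have : ∑ x, S.one i (single x g 1) * S.two i F * S.one i (single f x 1) =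
        ∑ b, ∑ d, F (g, b) (f, d) • S.one (i + 1) (single b d 1) := by
      have e : ∑ x, (single x g 1 ⊗ₖ 1 : M2 N K) * F * (single f x 1 ⊗ₖ 1) =
          1 ⊗ₖ of fun b d => F (g, b) (f, d) := by
        ext ⟨x, b⟩ ⟨y, d⟩
        simp [Matrix.sum_apply, mul_apply, Fintype.sum_prod_type, single_apply, one_apply, ite_and,
          eq_comm]
      have := congr_arg (S.two i) e
      rw [S.two_right i hi, map_eq_sum_single (S.one (i + 1))] at this
      simpa only [map_sum, map_mul, S.two_left i hi, of_apply] using this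
    have h2 := congr_arg L this
    simp only [map_sum, hL, map_smul, Finset.sum_const_zero] at h2
    exact h2.symm
  have h2 : ∀ a c, L (S.one (i + 1) (single c a 1)) = 0 := by
    intro a c
    have : ∑ f, ∑ g, Ψ (a, f) (c, g) •
        ∑ b, ∑ d, F (g, b) (f, d) • L (S.one (i + 1) (single b d 1)) = 0 := by simp [h1]
    simp only [Finset.smul_sum, smul_smul] at this
    have e : ∑ b, ∑ d, (∑ f, ∑ g, Ψ (a, f) (c, g) * F (g, b) (f, d)) •
        L (S.one (i + 1) (single b d 1)) = 0 := by
      rw [← this]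
      simp only [Finset.sum_smul]
      rw [sum_comm_pairs]
    simp only [h a] at e
    simpa [ite_and] using e
  rw [map_eq_sum_single]
  simp [h2]

end SiteSystem
end SiteSystem

section Braided

variable {K : Type*} [Field K] {N : ℕ} {E : Type*} [Ring E] [Algebra K E]

namespace SiteSystem

variable {m : ℕ} (S : SiteSystem K N E m) {i j : ℕ}

/-- The two-site operators which can be dragged through a pair of copies of `F`. -/
def braided (F : M2 N K) : Subalgebra K (M2 N K) where
  carrier := {X | ∀ i, i + 2 < m →
    S.two i X * (S.two (i + 1) F * S.two i F) = S.two (i + 1) F * S.two i F * S.two (i + 1) X ∧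
    S.two i F * S.two (i + 1) F * S.two i X = S.two (i + 1) X * (S.two i F * S.two (i + 1) F)}
  mul_mem' {X Y} hX hY i hi := by
    obtain ⟨h1, h2⟩ := hX i hi
    obtain ⟨h3, h4⟩ := hY i hi
    simp only [map_mul (S.two i) X Y, map_mul (S.two (i + 1)) X Y]
    exact ⟨by rw [mul_assoc, h3, ← mul_assoc, h1, mul_assoc],
      by rw [← mul_assoc, h2, mul_assoc, h4, mul_assoc]⟩
  add_mem' {X Y} hX hY i hi := by
    obtain ⟨h1, h2⟩ := hX i hi
    obtain ⟨h3, h4⟩ := hY i hi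
    simp only [map_add, add_mul, mul_add, h1, h2, h3, h4, and_self]
  algebraMap_mem' r i hi := by
    simp only [AlgHom.commutes]
    exact ⟨Algebra.commutes _ _, (Algebra.commutes _ _).symm⟩

variable {S} {F R Ψ X Y : M2 N K}

theorem braided_inv_mem (hX : X ∈ S.braided F) (h : X * Y = 1) (h' : Y * X = 1) :
    Y ∈ S.braided F := by
  intro i hi
  obtain ⟨h1, h2⟩ := hX i hi
  have e1 (j : ℕ) : S.two j X * S.two j Y = 1 := by rw [← map_mul, h, map_one]
  have e2 (j : ℕ) : S.two j Y * S.two j X = 1 := by rw [← map_mul, h', map_one]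
  constructor
  · rw [← mul_one (S.two i Y * _), ← e1 (i + 1), mul_assoc (S.two i Y), ← mul_assoc (_ * _), ← h1,
      ← mul_assoc, ← mul_assoc, e2, one_mul]
  · rw [← one_mul (_ * S.two i Y), ← e2 (i + 1), mul_assoc, ← mul_assoc _ _ (S.two i Y), ← h2,
      mul_assoc _ _ (S.two i Y), e1, mul_one]

theorem RFF_mem (hR : R ∈ S.braided F) (hF : F ∈ S.braided F) (h : IsUnit F) :
    RFF R F ∈ S.braided F := by
  have h' := (isUnit_iff_isUnit_det F).1 h
  have hF' := braided_inv_mem hF (mul_nonsing_inv F h') (nonsing_inv_mul F h')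
  exact mul_mem (mul_mem hF (mul_mem (mul_mem hF hR) hF')) hF'

variable (S)

theorem two_mul_two_inv (h : IsUnit F) (i : ℕ) : S.two i F * S.two i F⁻¹ = 1 := by
  rw [← map_mul, mul_nonsing_inv F ((isUnit_iff_isUnit_det F).1 h), map_one]

theorem two_inv_mul_two (h : IsUnit F) (i : ℕ) : S.two i F⁻¹ * S.two i F = 1 := by
  rw [← map_mul, nonsing_inv_mul F ((isUnit_iff_isUnit_det F).1 h), map_one]

variable {S}

theorem one_injective [Nontrivial E] (i : ℕ) : Function.Injective (S.one i) := by
  rcases isEmpty_or_nonempty (Fin N) with h | h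
  · exact Function.injective_of_subsingleton _
  · exact (S.one i).toRingHom.injective

theorem ptrace_conj [Nontrivial E] (hm : 2 < m) (h : IsClosedPair F Ψ) (hFu : IsUnit F)
    (hF : F ∈ S.braided F) (X : Matrix (Fin N) (Fin N) K) :
    ptrace (Dmat Ψ) (F * (X ⊗ₖ 1) * F⁻¹) = (Dmat Ψ * X).trace • 1 := by
  set D := Dmat Ψ with hD
  have h1 : ∀ i, S.two i F * S.two i F⁻¹ = 1 := S.two_mul_two_inv hFu
  have h2 : ∀ i, S.two i F⁻¹ * S.two i F = 1 := S.two_inv_mul_two hFu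
  have hT (i : ℕ) (hi : i + 1 < m) : S.qtrace D (i + 1) (S.two i F) = 1 := by
    rw [S.qtrace_two hi, hD, h.ptrace_eq_one, map_one]
  set L : E →ₗ[K] E := S.qtrace D 2 ∘ₗ LinearMap.mulLeft K (S.two 1 F) ∘ₗ
    LinearMap.mulRight K (S.two 1 F⁻¹) - S.qtrace D 1 with hL
  have key : L (S.one 1 X) = 0 := by
    refine S.map_one_succ_eq_zero (i := 0) h (by omega) L (fun X Y => ?_) X
    have hc (Y) (X) : Commute (S.two 1 Y) (S.one 0 X) :=
      S.commute_two_one (by omega) (by omega) (by omega) (by omega) Y X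
    have hb : S.two 1 F * S.two 0 F * S.two 1 F⁻¹ = S.two 0 F⁻¹ * S.two 1 F * S.two 0 F := by
      have := (hF 0 hm).1
      rw [zero_add] at this
      rw [← one_mul (S.two 1 F), ← h2 0, mul_assoc _ _ (S.two 1 F), mul_assoc _ (_ * _),
        mul_assoc (S.two 0 F) _ _, this, mul_assoc, mul_assoc _ (S.two 1 F), h1, mul_one, mul_assoc,
        ← mul_assoc (S.two 0 F⁻¹) (S.two 0 F), h2, one_mul]
    have e : S.two 1 F * (S.one 0 X * S.two 0 F * S.one 0 Y * S.two 1 F⁻¹) =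
        S.one 0 X * (S.two 0 F⁻¹ * S.two 1 F * S.two 0 F) * S.one 0 Y := by
      rw [← hb, mul_assoc _ (S.one 0 Y), ← (hc F⁻¹ Y).eq]
      simp only [← mul_assoc, (hc F X).eq]
    have hcc (j : ℕ) (hj : j = 1 ∨ j = 2) (X Y) : Commute (S.one 0 X) (S.one j Y) :=
      S.commute_one (by omega) (by omega) (by omega) _ _
    have hcc' (X Y) : Commute (S.two 0 X) (S.one 2 Y) :=
      S.commute_two_one (by omega) (by omega) (by omega) (by omega) _ _
    simp only [hL, LinearMap.sub_apply, LinearMap.comp_apply, LinearMap.mulLeft_apply,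
      LinearMap.mulRight_apply, e]
    rw [S.qtrace_mul_right (hcc 2 (by simp) Y), S.qtrace_mul_left (hcc 2 (by simp) X),
      S.qtrace_mul_right (hcc 1 (by simp) Y), S.qtrace_mul_left (hcc 1 (by simp) X),
      S.qtrace_mul_right (hcc' F), S.qtrace_mul_left (hcc' F⁻¹), hT 1 (by omega),
      hT 0 (by omega), mul_one, h2, sub_self]
  apply S.one_injective 1
  rw [← S.qtrace_two (by omega), map_smul, map_one, ← S.qtrace_one 1, map_mul (S.two 1), map_mul (S.two 1),
    S.two_left 1 (by omega), mul_assoc]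
  exact sub_eq_zero.1 key

theorem kronecker_mul_eq [Nontrivial E] (hm : 3 < m) (h : IsClosedPair F Ψ) (hFu : IsUnit F)
    (hF : F ∈ S.braided F) (hR : R ∈ S.braided F) :
    (Dmat Ψ ⊗ₖ Dmat Ψ) * R = RFF R F * (Dmat Ψ ⊗ₖ Dmat Ψ) := by
  set D := Dmat Ψ with hD
  have h1 : ∀ i, S.two i F * S.two i F⁻¹ = 1 := S.two_mul_two_inv hFu
  have h2 : ∀ i, S.two i F⁻¹ * S.two i F = 1 := S.two_inv_mul_two hFu
  have hT (i : ℕ) (hi : i + 1 < m) : S.qtrace D (i + 1) (S.two i F) = 1 := by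
    rw [S.qtrace_two hi, hD, h.ptrace_eq_one, map_one]
  have hR' := RFF_mem hR hF hFu
  set B := S.two 1 F * S.two 0 F * S.two 2 F * S.two 1 F with hB
  have h02 (X Y) : S.two 0 X * S.two 2 Y = S.two 2 Y * S.two 0 X :=
    S.commute_two_two (by omega) (by omega) X Y
  have hB1 (X) (hX : X ∈ S.braided F) : B * S.two 0 X = S.two 2 X * B := by
    have e1 := (hX 0 (by omega)).2
    have e2 := (hX 1 (by omega)).2
    norm_num at e1 e2
    rw [hB, mul_assoc _ (S.two 0 F), h02]
    calc _ = S.two 1 F * S.two 2 F * (S.two 0 F * S.two 1 F * S.two 0 X) := by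
          simp only [mul_assoc]
      _ = (S.two 1 F * S.two 2 F * S.two 1 X) * (S.two 0 F * S.two 1 F) := by
          rw [e1]; simp only [mul_assoc]
      _ = _ := by rw [e2]; simp only [mul_assoc]
  have hB2 (X) (hX : X ∈ S.braided F) : B * S.two 2 X = S.two 0 X * B := by
    have e1 := (hX 0 (by omega)).1
    have e2 := (hX 1 (by omega)).1
    norm_num at e1 e2
    calc _ = S.two 1 F * S.two 0 F * (S.two 2 F * S.two 1 F * S.two 2 X) := by
          simp only [hB, mul_assoc]
      _ = (S.two 1 F * S.two 0 F * S.two 1 X) * (S.two 2 F * S.two 1 F) := by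
          rw [← e2]; simp only [mul_assoc]
      _ = _ := by rw [← e1]; simp only [hB, mul_assoc]
  set Φ : E →ₗ[K] E := S.qtrace D 2 ∘ₗ S.qtrace D 3 with hΦ
  set ψ : E →ₗ[K] E := Φ ∘ₗ LinearMap.mulLeft K (S.two 2 R) -
    Φ ∘ₗ LinearMap.mulRight K (S.two 2 (RFF R F)) with hψ
  have hc1 (i j : ℕ) (hi : i < m) (hj : j < m) (hij : i ≠ j) (X Y) :
    S.one i X * S.one j Y = S.one j Y * S.one i X := S.commute_one hij hi hj X Y
  have hc2 (i j : ℕ) (hi : i + 1 < m) (hj : j < m) (hij : j ≠ i) (hij' : j ≠ i + 1) (X Y) :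
    S.two i X * S.one j Y = S.one j Y * S.two i X := S.commute_two_one hi hj hij hij' X Y
  have hΦl {Z : E} (hZ : ∀ X, Commute Z (S.one 2 X)) (hZ' : ∀ X, Commute Z (S.one 3 X)) (Y : E) :
      Φ (Z * Y) = Z * Φ Y := by
    rw [hΦ, LinearMap.comp_apply, S.qtrace_mul_left hZ', S.qtrace_mul_left hZ]; rfl
  have hΦr {Z : E} (hZ : ∀ X, Commute Z (S.one 2 X)) (hZ' : ∀ X, Commute Z (S.one 3 X)) (Y : E) :
      Φ (Y * Z) = Φ Y * Z := by
    rw [hΦ, LinearMap.comp_apply, S.qtrace_mul_right hZ', S.qtrace_mul_right hZ]; rfl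
  have hψl (i : ℕ) (hi : i < 2) (X) (Y : E) : ψ (S.one i X * Y) = S.one i X * ψ Y := by
    simp only [hψ, LinearMap.sub_apply, LinearMap.comp_apply, LinearMap.mulLeft_apply,
      LinearMap.mulRight_apply, mul_sub]
    have hc (j : ℕ) (hj : j = 2 ∨ j = 3) (Z) : Commute (S.one i X) (S.one j Z) :=
      S.commute_one (by omega) (by omega) (by omega) _ _
    rw [← mul_assoc, hc2 2 i (by omega) (by omega) (by omega) (by omega), mul_assoc, mul_assoc,
      hΦl (hc 2 (by simp)) (hc 3 (by simp)), hΦl (hc 2 (by simp)) (hc 3 (by simp))]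
  have hψr (i : ℕ) (hi : i < 2) (X) (Y : E) : ψ (Y * S.one i X) = ψ Y * S.one i X := by
    simp only [hψ, LinearMap.sub_apply, LinearMap.comp_apply, LinearMap.mulLeft_apply,
      LinearMap.mulRight_apply, sub_mul]
    have hc (j : ℕ) (hj : j = 2 ∨ j = 3) (Z) : Commute (S.one i X) (S.one j Z) :=
      S.commute_one (by omega) (by omega) (by omega) _ _
    rw [mul_assoc Y, ← hc2 2 i (by omega) (by omega) (by omega) (by omega), ← mul_assoc,
      ← mul_assoc, hΦr (hc 2 (by simp)) (hc 3 (by simp)), hΦr (hc 2 (by simp)) (hc 3 (by simp))]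
  have hψB : ψ B = 0 := by
    have hc (i j : ℕ) (hij : i + 1 < j) (hj : j < m) (X Y) : Commute (S.two i X) (S.one j Y) :=
      S.commute_two_one (by omega) (by omega) (by omega) (by omega) _ _
    have hΦB : Φ B = S.two 0 F * S.two 0 F := by
      have := (hF 0 (by omega)).1
      rw [zero_add, ← mul_assoc] at this
      rw [hΦ, LinearMap.comp_apply, hB, S.qtrace_mul_right (hc 1 3 (by omega) (by omega) F),
        S.qtrace_mul_left
          (fun X => (hc 1 3 (by omega) (by omega) F X).mul_left (hc 0 3 (by omega) (by omega) F X)),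
        hT 2 (by omega), mul_one, ← this, S.qtrace_mul_right (hc 0 2 (by omega) (by omega) F),
        S.qtrace_mul_left (hc 0 2 (by omega) (by omega) F), hT 1 (by omega), mul_one]
    simp only [hψ, LinearMap.sub_apply, LinearMap.comp_apply, LinearMap.mulLeft_apply,
      LinearMap.mulRight_apply]
    rw [← hB1 R hR, hB2 _ hR', hΦr (hc 0 2 (by omega) (by omega) R) (hc 0 3 (by omega) (by omega) R),
      hΦl (hc 0 2 (by omega) (by omega) _) (hc 0 3 (by omega) (by omega) _), hΦB, sub_eq_zero]
    simp only [← map_mul, RFF, mul_assoc]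
    have h' := nonsing_inv_mul F ((isUnit_iff_isUnit_det F).1 hFu)
    rw [← mul_assoc F⁻¹ F F, h', one_mul, h', mul_one]
  have g1 (Z) : ψ (S.two 1 F * (S.one 1 Z * (S.two 2 F * S.two 1 F))) = 0 := by
    refine S.map_one_succ_eq_zero (i := 0) h (by omega) (ψ ∘ₗ LinearMap.mulLeft K (S.two 1 F) ∘ₗ
      LinearMap.mulRight K (S.two 2 F * S.two 1 F)) (fun X Y => ?_) Z
    have e : S.two 1 F * (S.one 0 X * S.two 0 F * S.one 0 Y * (S.two 2 F * S.two 1 F)) =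
        S.one 0 X * (B * S.one 0 Y) := by
      have c1 := hc2 1 0 (by omega) (by omega) (by omega) (by omega) F
      have c2 := hc2 2 0 (by omega) (by omega) (by omega) (by omega) F
      simp only [hB, mul_assoc, c1]
      rw [← mul_assoc (S.two 2 F) (S.one 0 Y), c2, ← mul_assoc _ (S.one 0 X), c1]
      simp only [mul_assoc]
    simp only [LinearMap.comp_apply, LinearMap.mulLeft_apply, LinearMap.mulRight_apply, e]
    rw [hψl 0 (by omega), hψr 0 (by omega), hψB, zero_mul, mul_zero]
  have g2 (X Y) : ψ (S.one 2 X * (S.two 2 F * S.two 1 F * S.one 1 Y)) = 0 := by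
    refine S.map_one_succ_eq_zero (i := 1) h (by omega) (ψ ∘ₗ
      LinearMap.mulRight K (S.two 2 F * S.two 1 F * S.one 1 Y)) (fun X Z => ?_) X
    have e : S.one 1 X * S.two 1 F * S.one 1 Z * (S.two 2 F * S.two 1 F * S.one 1 Y) =
        S.one 1 X * (S.two 1 F * (S.one 1 Z * (S.two 2 F * S.two 1 F)) * S.one 1 Y) := by
      simp only [mul_assoc]
    simp only [LinearMap.comp_apply, LinearMap.mulRight_apply, e]
    rw [hψl 1 (by omega), hψr 1 (by omega), g1, zero_mul, mul_zero]
  have g3 (X Y) : ψ (S.one 2 X * S.two 2 F * S.one 2 Y) = 0 := by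
    refine S.map_one_succ_eq_zero (i := 1) h (by omega) (ψ ∘ₗ
      LinearMap.mulLeft K (S.one 2 X * S.two 2 F)) (fun Z Y => ?_) Y
    have e : S.one 2 X * S.two 2 F * (S.one 1 Z * S.two 1 F * S.one 1 Y) =
        S.one 1 Z * (S.one 2 X * (S.two 2 F * S.two 1 F * S.one 1 Y)) := by
      rw [← mul_assoc, ← mul_assoc, mul_assoc _ (S.two 2 F),
        hc2 2 1 (by omega) (by omega) (by omega) (by omega), ← mul_assoc (S.one 2 X),
        hc1 2 1 (by omega) (by omega) (by omega)]
      simp only [mul_assoc]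
    simp only [LinearMap.comp_apply, LinearMap.mulLeft_apply, e]
    rw [hψl 1 (by omega), g2, mul_zero]
  have g4 (X Y) : ψ (S.one 2 X * S.one 3 Y) = 0 := by
    refine S.map_one_succ_eq_zero (i := 2) h (by omega) (ψ ∘ₗ
      LinearMap.mulLeft K (S.one 2 X)) (fun Z Y => ?_) Y
    simp only [LinearMap.comp_apply, LinearMap.mulLeft_apply, ← mul_assoc, ← map_mul]
    exact g3 _ _
  have g5 (W) : ((D ⊗ₖ D) * R * W).trace = ((RFF R F * (D ⊗ₖ D)) * W).trace := by
    have hW : ψ (S.two 2 W) = 0 := by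
      rw [S.two_eq_sum (by omega)]
      simp [g4]
    rw [hψ, hΦ] at hW
    simp only [LinearMap.sub_apply, LinearMap.comp_apply, LinearMap.mulLeft_apply,
      LinearMap.mulRight_apply, S.qtrace_qtrace (show 2 + 1 < m by omega), ← map_mul,
      subTrace_map] at hW
    rw [← sub_smul, ← Algebra.algebraMap_eq_smul_one,
      map_eq_zero_iff _ (FaithfulSMul.algebraMap_injective K E), sub_eq_zero] at hW
    rw [mul_assoc, hW, mul_assoc (RFF R F), trace_mul_comm (RFF R F), mul_assoc]
  ext a b
  have := g5 (single b a 1)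
  simpa [trace_mul_single] using this

end SiteSystem
end Braided

/-! ### Iterated quantum traces and quantum matrices -/

section QuantumMatrix

variable {K : Type*} [Field K] {N : ℕ} {E : Type*} [Ring E] [Algebra K E]

theorem ascProd_add (R : ℕ → E) (p l : ℕ) :
    ∀ l', ascProd R p (l + l') = ascProd R p l * ascProd R (p + l) l'
  | 0 => by simp [ascProd]
  | l' + 1 => by rw [← add_assoc, ascProd, ascProd_add R p l l', ascProd, mul_assoc, add_assoc]

namespace SiteSystem

variable {m : ℕ} (S : SiteSystem K N E m) {i j : ℕ} {D : Matrix (Fin N) (Fin N) K}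
  {F R R' : M2 N K}

theorem qtrace_conj (hi : i + 1 < m)
    (hc : ∀ X, ptrace D (F * (X ⊗ₖ 1) * F⁻¹) = (D * X).trace • 1) {Y : E}
    (hY : ∀ X, Commute Y (S.one (i + 1) X)) :
    S.qtrace D (i + 1) (S.two i F * Y * S.two i F⁻¹) = S.qtrace D i Y := by
  rw [← sum_map_single_mul_subTrace (S.one i) Y]
  simp only [Finset.mul_sum, Finset.sum_mul, map_sum]
  refine Finset.sum_congr rfl fun a _ => Finset.sum_congr rfl fun b _ => ?_
  set Z := subTrace (S.one i) (S.one i (single b a 1) * Y) with hZ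
  have hZi (X) : Commute Z (S.one i X) := commute_subTrace_map _ _ _
  have hZi' (X) : Commute Z (S.one (i + 1) X) :=
    (commute_subTrace _ (fun W => (S.commute_one_succ hi W X).symm)
      ((S.commute_one_succ hi _ X).symm.mul_right (hY X).symm)).symm
  rw [mul_assoc, mul_assoc, (S.commute_two hi hZi hZi' F⁻¹).eq, ← mul_assoc, ← mul_assoc,
    ← S.two_left i hi, ← map_mul, ← map_mul, S.qtrace_mul_right hZi', S.qtrace_two hi, hc,
    S.two_left i hi, S.qtrace_mul_right hZi, S.qtrace_one, map_smul, map_one]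

theorem qtrace_qtrace_two_mul (hi : i + 1 < m) (hk : (D ⊗ₖ D) * R = R' * (D ⊗ₖ D)) (Y : E) :
    S.qtrace D i (S.qtrace D (i + 1) (S.two i R * Y)) =
      S.qtrace D i (S.qtrace D (i + 1) (Y * S.two i R')) := by
  rw [S.qtrace_qtrace hi, S.qtrace_qtrace hi, ← mul_assoc, ← map_mul (S.two i), hk,
    map_mul (S.two i), mul_assoc, ← subTrace_mul_comm, mul_assoc]

variable (D) in
/-- The quantum trace over the sites `s, …, s + l - 1`. -/
noncomputable def qtraces (s : ℕ) : ℕ → E →ₗ[K] E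
  | 0 => LinearMap.id
  | l + 1 => qtraces s l ∘ₗ S.qtrace D (s + l)

theorem qtraces_succ (s l : ℕ) (Y : E) :
    S.qtraces D s (l + 1) Y = S.qtraces D s l (S.qtrace D (s + l) Y) := rfl

theorem qtraces_add (s l : ℕ) (Y : E) : ∀ l', S.qtraces D s (l + l') Y =
    S.qtraces D s l (S.qtraces D (s + l) l' Y)
  | 0 => rfl
  | l' + 1 => by
    rw [← add_assoc, qtraces_succ, qtraces_add s l _ l', qtraces_succ, add_assoc]

theorem qtraces_mul_left {Z : E} {s : ℕ} : ∀ {l}, (∀ i, s ≤ i → i < s + l → ∀ X,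
    Commute Z (S.one i X)) → ∀ Y, S.qtraces D s l (Z * Y) = Z * S.qtraces D s l Y
  | 0, _, _ => rfl
  | l + 1, h, Y => by
    rw [qtraces_succ, S.qtrace_mul_left (h _ (by omega) (by omega)),
      qtraces_mul_left fun i hi hl => h i hi (by omega), qtraces_succ]

theorem qtraces_mul_right {Z : E} {s : ℕ} : ∀ {l}, (∀ i, s ≤ i → i < s + l → ∀ X,
    Commute Z (S.one i X)) → ∀ Y, S.qtraces D s l (Y * Z) = S.qtraces D s l Y * Z
  | 0, _, _ => rfl
  | l + 1, h, Y => by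
    rw [qtraces_succ, S.qtrace_mul_right (h _ (by omega) (by omega)),
      qtraces_mul_right fun i hi hl => h i hi (by omega), qtraces_succ]

theorem commute_qtraces {Z Y : E} {s l : ℕ} (h : ∀ i, s ≤ i → i < s + l → ∀ X,
    Commute Z (S.one i X)) (hY : Commute Z Y) : Commute Z (S.qtraces D s l Y) := by
  rw [commute_iff_eq, ← S.qtraces_mul_left h, hY.eq, S.qtraces_mul_right h]

theorem commute_qtraces_one {s : ℕ} {X : Matrix (Fin N) (Fin N) K} : ∀ {l} (Y : E),
    s + l ≤ m → s ≤ i → i < s + l → Commute (S.qtraces D s l Y) (S.one i X)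
  | 0, _, _, _, _ => by omega
  | l + 1, Y, hl, hi, hil => by
    rcases Nat.lt_or_ge i (s + l) with h | h
    · exact commute_qtraces_one (l := l) _ (by omega) hi h
    · obtain rfl : i = s + l := by omega
      exact (S.commute_qtraces (fun j _ hj W => S.commute_one (by omega) (by omega) (by omega) _ _)
        (S.commute_qtrace_one _ _ _).symm).symm

theorem qtraces_two_mul (hk : (D ⊗ₖ D) * R = R' * (D ⊗ₖ D)) {s : ℕ} : ∀ {l} (Y : E), s ≤ i →
    i + 1 < s + l → s + l ≤ m →
    S.qtraces D s l (S.two i R * Y) = S.qtraces D s l (Y * S.two i R')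
  | 0, _, _, _, _ => by omega
  | l + 1, Y, hi, hil, hl => by
    rcases Nat.lt_or_ge (i + 1) (s + l) with h | h
    · have hc (W X) : Commute (S.two i W) (S.one (s + l) X) :=
        S.commute_two_one (by omega) (by omega) (by omega) (by omega) W X
      rw [qtraces_succ, qtraces_succ, S.qtrace_mul_left (hc R), S.qtrace_mul_right (hc R'),
        qtraces_two_mul hk _ hi h (by omega)]
    · obtain ⟨l, rfl⟩ : ∃ l', l = l' + 1 := ⟨l - 1, by omega⟩
      obtain rfl : i = s + l := by omega
      rw [qtraces_succ, qtraces_succ, qtraces_succ, qtraces_succ, ← add_assoc,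
        S.qtrace_qtrace_two_mul (by omega) hk]

/-- A two-site operator as a unit. -/
@[simps] noncomputable def twoUnit (hF : IsUnit F) (i : ℕ) : Eˣ :=
  ⟨S.two i F, S.two i F⁻¹, S.two_mul_two_inv hF i, S.two_inv_mul_two hF i⟩

/-- The product `F_s ⋯ F_{s+l-1}`. -/
noncomputable def shiftUnit (hF : IsUnit F) (s : ℕ) : ℕ → Eˣ
  | 0 => 1
  | l + 1 => shiftUnit hF s l * S.twoUnit hF (s + l)

theorem commute_shiftUnit (hF : IsUnit F) {s : ℕ} {Z : E} : ∀ {l},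
    (∀ i, s ≤ i → i < s + l → Commute Z (S.two i F)) → Commute Z (S.shiftUnit hF s l)
  | 0, _ => Commute.one_right Z
  | l + 1, h => (commute_shiftUnit hF fun i hi hl => h i hi (by omega)).mul_right
      (h (s + l) (by omega) (by omega))

theorem qtraces_shift (hF : IsUnit F)
    (hc : ∀ X, ptrace D (F * (X ⊗ₖ 1) * F⁻¹) = (D * X).trace • 1) {s : ℕ} :
    ∀ {l}, s + l < m → ∀ {Y Y' : E}, (∀ X, Commute Y (S.one (s + l) X)) →
    S.shiftUnit hF s l * Y = Y' * S.shiftUnit hF s l →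
    S.qtraces D (s + 1) l Y' = S.qtraces D s l Y
  | 0, _, Y, Y', _, h => by simpa [shiftUnit, qtraces, eq_comm] using h
  | l + 1, hl, Y, Y', hY, h => by
    have h' : Y' = S.shiftUnit hF s l * (S.two (s + l) F * Y * S.two (s + l) F⁻¹) *
        ↑(S.shiftUnit hF s l)⁻¹ := by
      rw [(Units.eq_mul_inv_iff_mul_eq _).2 h.symm, shiftUnit, _root_.mul_inv_rev]
      simp [mul_assoc]
    have hcG (X) : Commute (S.shiftUnit hF s l : E) (S.one (s + l + 1) X) :=
      (S.commute_shiftUnit hF fun i _ _ =>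
        (S.commute_two_one (by omega) (by omega) (by omega) (by omega) _ _).symm).symm
    rw [qtraces_succ, qtraces_succ, add_right_comm, h',
      S.qtrace_mul_right fun X => (hcG X).units_inv_left, S.qtrace_mul_left hcG,
      S.qtrace_conj (i := s + l) (by omega) hc hY]
    exact qtraces_shift hF hc (by omega) (S.commute_qtrace_one _ _) (by simp)

theorem shiftUnit_mul_two (hF : IsUnit F) (hR : R ∈ S.braided F) {s : ℕ} : ∀ {l}, s ≤ i →
    i + 1 < s + l → s + l < m →
    S.shiftUnit hF s l * S.two i R = S.two (i + 1) R * S.shiftUnit hF s l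
  | 0, _, _, _ => by omega
  | l + 1, hi, hil, hl => by
    rcases Nat.lt_or_ge (i + 1) (s + l) with h | h
    · simp only [shiftUnit, Units.val_mul, val_twoUnit]
      rw [mul_assoc, ← (S.commute_two_two h (by omega) _ _).eq, ← mul_assoc,
        shiftUnit_mul_two hF hR hi h (by omega), mul_assoc]
    · obtain ⟨l, rfl⟩ : ∃ l', l = l' + 1 := ⟨l - 1, by omega⟩
      obtain rfl : i = s + l := by omega
      have hcG : Commute (S.two (s + l + 1) R) (S.shiftUnit hF s l : E) :=
        S.commute_shiftUnit hF fun i _ _ => (S.commute_two_two (by omega) (by omega) _ _).symm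
      simp only [shiftUnit, Units.val_mul, val_twoUnit]
      rw [← mul_assoc (S.two _ R), ← mul_assoc (S.two _ R), hcG.eq, mul_assoc, mul_assoc,
        ← mul_assoc (S.two _ F), ← add_assoc, (hR (s + l) (by omega)).2]
      simp only [mul_assoc]

variable (F) in
/-- The copies `M_{\overline{k}}` of an element `M₀` on the first site. -/
noncomputable def bar (M₀ : E) : ℕ → E
  | 0 => M₀
  | k + 1 => S.two k F * bar M₀ k * S.two k F⁻¹

variable {M₀ : E} (hM₀ : ∀ i, 1 ≤ i → i < m → ∀ X, Commute M₀ (S.one i X))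

theorem bar_succ_mul (hF : IsUnit F) (k : ℕ) :
    S.bar F M₀ (k + 1) * S.two k F = S.two k F * S.bar F M₀ k := by
  rw [bar, mul_assoc, S.two_inv_mul_two hF, mul_one]

include hM₀

theorem commute_bar_one (X : Matrix (Fin N) (Fin N) K) :
    ∀ {k}, k < i → i < m → Commute (S.bar F M₀ k) (S.one i X)
  | 0, h, hi => hM₀ i h hi X
  | k + 1, h, hi => ((S.commute_two_one (by omega) hi (by omega) (by omega) _ _).mul_left
      (commute_bar_one X (by omega) hi)).mul_left
      (S.commute_two_one (by omega) hi (by omega) (by omega) _ _)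

theorem commute_bar_two_gt (X : M2 N K) {k : ℕ} (h : k < i) (hi : i + 1 < m) :
    Commute (S.bar F M₀ k) (S.two i X) :=
  S.commute_two hi (fun _ => S.commute_bar_one hM₀ _ h (by omega))
    (fun _ => S.commute_bar_one hM₀ _ (by omega) (by omega)) X

theorem commute_bar_two_lt (hF : IsUnit F) (hR : R ∈ S.braided F) :
    ∀ {k}, i + 1 < k → k < m → Commute (S.bar F M₀ k) (S.two i R)
  | 0, h, _ => by omega
  | k + 1, h, hk => by
    rcases Nat.lt_or_ge (i + 1) k with h' | h'
    · exact ((S.commute_two_two h' hk _ _).symm.mul_left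
        (commute_bar_two_lt hF hR h' (by omega))).mul_left
        (S.commute_two_two h' hk _ _).symm
    · obtain rfl : k = i + 1 := by omega
      have h1 := (hR i (by omega)).1
      set u := S.twoUnit hF (i + 1) * S.twoUnit hF i with hu
      have h2 : S.bar F M₀ (i + 1 + 1) = u * S.bar F M₀ i * ↑u⁻¹ := by
        simp [hu, bar, mul_assoc]
      have h3 : S.two i R * u = u * S.two (i + 1) R := by simpa [hu] using h1
      have h4 : ↑u⁻¹ * S.two i R = S.two (i + 1) R * ↑u⁻¹ := by
        rw [Units.inv_mul_eq_iff_eq_mul, ← mul_assoc, ← h3, mul_assoc, Units.mul_inv, mul_one]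
      rw [commute_iff_eq, h2, mul_assoc, h4, ← mul_assoc, ← mul_assoc, ← mul_assoc, h3,
        mul_assoc (u : E), (S.commute_bar_two_gt hM₀ R (by omega) hk).eq]
      simp only [mul_assoc]

theorem shiftUnit_mul_bar (hF : IsUnit F) (hFF : F ∈ S.braided F) {s k : ℕ} : ∀ {l}, s ≤ k →
    k < s + l → s + l < m →
    S.shiftUnit hF s l * S.bar F M₀ k = S.bar F M₀ (k + 1) * S.shiftUnit hF s l
  | 0, _, _, _ => by omega
  | l + 1, hi, hil, hl => by
    rcases Nat.lt_or_ge k (s + l) with h | h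
    · simp only [shiftUnit, Units.val_mul, val_twoUnit]
      rw [mul_assoc, ← (S.commute_bar_two_gt hM₀ _ h (by omega)).eq, ← mul_assoc,
        shiftUnit_mul_bar hF hFF hi h (by omega), mul_assoc]
    · obtain rfl : k = s + l := by omega
      have hcG : Commute (S.bar F M₀ (s + l + 1)) (S.shiftUnit hF s l : E) :=
        S.commute_shiftUnit hF fun i _ _ => S.commute_bar_two_lt hM₀ hF hFF (by omega) (by omega)
      simp only [shiftUnit, Units.val_mul, val_twoUnit]
      rw [← mul_assoc, hcG.eq, mul_assoc, mul_assoc, S.bar_succ_mul hF]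

theorem two_mul_bar_mul_bar (hF : IsUnit F) (hFF : F ∈ S.braided F) (hR : R ∈ S.braided F)
    (hR' : R' ∈ S.braided F)
    (h : S.two 0 R * (M₀ * S.bar F M₀ 1) = M₀ * S.bar F M₀ 1 * S.two 0 R') :
    ∀ i, i + 1 < m → S.two i R * (S.bar F M₀ i * S.bar F M₀ (i + 1)) =
      S.bar F M₀ i * S.bar F M₀ (i + 1) * S.two i R'
  | 0, _ => h
  | i + 1, hi => by
    have ih := two_mul_bar_mul_bar hF hFF hR hR' h i (by omega)
    set u := S.shiftUnit hF i 2
    have e1 : u * S.two i R = S.two (i + 1) R * u :=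
      S.shiftUnit_mul_two hF hR le_rfl (by omega) (by omega)
    have e2 : u * S.two i R' = S.two (i + 1) R' * u :=
      S.shiftUnit_mul_two hF hR' le_rfl (by omega) (by omega)
    have e3 : u * S.bar F M₀ i = S.bar F M₀ (i + 1) * u :=
      S.shiftUnit_mul_bar hM₀ hF hFF le_rfl (by omega) (by omega)
    have e4 : u * S.bar F M₀ (i + 1) = S.bar F M₀ (i + 1 + 1) * u :=
      S.shiftUnit_mul_bar hM₀ hF hFF (by omega) (by omega) (by omega)
    have e5 : S.bar F M₀ (i + 1) * S.bar F M₀ (i + 1 + 1) * u =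
        u * (S.bar F M₀ i * S.bar F M₀ (i + 1)) := by
      rw [mul_assoc, ← e4, ← mul_assoc, ← e3, mul_assoc]
    rw [← u.mul_left_inj, mul_assoc, e5, ← mul_assoc, ← e1, mul_assoc, ih, mul_assoc _ _ (u : E),
      ← e2, ← mul_assoc, ← mul_assoc _ (u : E), e5]

theorem commute_two_ascProd_bar_lt (X : M2 N K) {s : ℕ} (hi : i + 1 < m) : ∀ {l}, s + l ≤ i →
    Commute (S.two i X) (ascProd (S.bar F M₀) s l)
  | 0, _ => Commute.one_right _
  | l + 1, h => (commute_two_ascProd_bar_lt X hi (by omega)).mul_right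
      (S.commute_bar_two_gt hM₀ X (by omega) hi).symm

theorem commute_ascProd_bar_one (X : Matrix (Fin N) (Fin N) K) {s : ℕ} (hi : i < m) :
    ∀ {l}, s + l ≤ i → Commute (ascProd (S.bar F M₀) s l) (S.one i X)
  | 0, _ => Commute.one_left _
  | l + 1, h => (commute_ascProd_bar_one X hi (by omega)).mul_left
      (S.commute_bar_one hM₀ X (by omega) hi)

theorem two_mul_ascProd_bar (hF : IsUnit F) (hFF : F ∈ S.braided F) (hR : R ∈ S.braided F)
    (hR' : R' ∈ S.braided F)
    (h : S.two 0 R * (M₀ * S.bar F M₀ 1) = M₀ * S.bar F M₀ 1 * S.two 0 R') :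
    ∀ {k}, i + 1 < k → k ≤ m → S.two i R * ascProd (S.bar F M₀) 0 k =
      ascProd (S.bar F M₀) 0 k * S.two i R'
  | 0, _, _ => by omega
  | k + 1, hi, hk => by
    rcases Nat.lt_or_ge (i + 1) k with h' | h'
    · rw [ascProd, ← mul_assoc, two_mul_ascProd_bar hF hFF hR hR' h h' (by omega), mul_assoc,
        zero_add, ← (S.commute_bar_two_lt hM₀ hF hR' h' (by omega)).eq, mul_assoc]
    · obtain rfl : k = i + 1 := by omega
      rw [ascProd, ascProd, zero_add, zero_add, mul_assoc (ascProd _ _ _), ← mul_assoc,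
        (S.commute_two_ascProd_bar_lt hM₀ R (by omega) (by omega)).eq, mul_assoc,
        S.two_mul_bar_mul_bar hM₀ hF hFF hR hR' h i (by omega), ← mul_assoc]

theorem shiftUnit_mul_ascProd_bar (hF : IsUnit F) (hFF : F ∈ S.braided F) {s l : ℕ}
    (hl : s + l < m) : ∀ {k}, k ≤ l → S.shiftUnit hF s l * ascProd (S.bar F M₀) s k =
      ascProd (S.bar F M₀) (s + 1) k * S.shiftUnit hF s l
  | 0, _ => by simp [ascProd]
  | k + 1, hk => by
    rw [ascProd, ← mul_assoc, shiftUnit_mul_ascProd_bar hF hFF hl (by omega), mul_assoc,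
      S.shiftUnit_mul_bar hM₀ hF hFF (by omega) (by omega) hl, ascProd, add_right_comm, mul_assoc]

theorem qtraces_asym_mul_ascProd_bar (hF : IsUnit F)
    (hc : ∀ X, ptrace D (F * (X ⊗ₖ 1) * F⁻¹) = (D * X).trace • 1)
    (hFF : F ∈ S.braided F) (hR : R ∈ S.braided F) (q : K) {l : ℕ} : ∀ s, s + l ≤ m →
    S.qtraces D s l (asym q (S.two · R) s l * ascProd (S.bar F M₀) s l) =
      S.qtraces D 0 l (asym q (S.two · R) 0 l * ascProd (S.bar F M₀) 0 l)
  | 0, _ => rfl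
  | s + 1, h => by
    rw [← qtraces_asym_mul_ascProd_bar hF hc hFF hR q s (by omega)]
    refine S.qtraces_shift hF hc (by omega) (fun X => Commute.mul_left
      (commute_asym fun i _ _ => (S.commute_two_one (by omega) (by omega) (by omega) (by omega)
        R X).symm).symm (S.commute_ascProd_bar_one hM₀ X (by omega) le_rfl)) ?_
    rw [← mul_assoc, mul_asym_eq_asym_mul (R' := (S.two · R)) (p' := s + 1) _ fun i hi => by
      rw [add_right_comm]; exact S.shiftUnit_mul_two hF hR (by omega) (by omega) (by omega),
      mul_assoc, S.shiftUnit_mul_ascProd_bar hM₀ hF hFF (by omega) le_rfl, mul_assoc]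

/-- The inverse Cayley–Hamilton–Newton identity for an abstract system of sites. -/
theorem qtraces_ascProd_eq_sum (hF : IsUnit F)
    (hc : ∀ X, ptrace D (F * (X ⊗ₖ 1) * F⁻¹) = (D * X).trace • 1)
    (hk : (D ⊗ₖ D) * R = R' * (D ⊗ₖ D))
    (hFF : F ∈ S.braided F) (hR : R ∈ S.braided F) (hR' : R' ∈ S.braided F)
    (h : S.two 0 R * (M₀ * S.bar F M₀ 1) = M₀ * S.bar F M₀ 1 * S.two 0 R')
    {q : K} (hq : q ≠ 0) (hqn : ∀ n, 1 ≤ n → qInt q n ≠ 0) (hq1 : q - q⁻¹ ≠ 0)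
    (hH : IsHeckeSeq q (S.two · R) (m - 1)) {j : ℕ} (hj : j < m) :
    S.qtraces D 1 j (ascProd (S.two · R) 0 j * ascProd (S.bar F M₀) 0 (j + 1)) =
      ∑ i ∈ Finset.range (j + 1), ((-1 : K) ^ i * q ^ (j - i) * qInt q (i + 1)) •
        (S.qtraces D 1 i (asym q (S.two · R) 0 (i + 1) * ascProd (S.bar F M₀) 0 (i + 1)) *
          S.qtraces D 0 (j - i)
            (asym (-q⁻¹) (S.two · R) 0 (j - i) * ascProd (S.bar F M₀) 0 (j - i))) := by
  have key := map_ascProd_eq_sum hq hqn hq1 hH j 0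
    (S.qtraces D 1 j ∘ₗ LinearMap.mulRight K (ascProd (S.bar F M₀) 0 (j + 1))) (by omega)
    (fun i hi hij X => by
      simp only [LinearMap.comp_apply, LinearMap.mulRight_apply]
      rw [mul_assoc, S.qtraces_two_mul hk _ (by omega) (by omega) (by omega), mul_assoc, mul_assoc,
        S.two_mul_ascProd_bar hM₀ hF hFF hR hR' h (by omega) (by omega)])
  simp only [LinearMap.comp_apply, LinearMap.mulRight_apply] at key
  rw [key]
  refine Finset.sum_congr rfl fun i hi => congrArg _ ?_
  obtain ⟨l, rfl⟩ : ∃ l, j = i + l := ⟨j - i, by have := Finset.mem_range.1 hi; omega⟩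
  rw [Nat.add_sub_cancel_left, zero_add, S.qtraces_add, add_comm 1 i, add_right_comm i l 1]
  have e : asym (-q⁻¹) (S.two · R) (i + 1) l * ascProd (S.bar F M₀) 0 (i + 1 + l) =
      ascProd (S.bar F M₀) 0 (i + 1) *
        (asym (-q⁻¹) (S.two · R) (i + 1) l * ascProd (S.bar F M₀) (i + 1) l) := by
    have : Commute (ascProd (S.bar F M₀) 0 (i + 1)) (asym (-q⁻¹) (S.two · R) (i + 1) l) :=
      commute_asym fun k _ _ =>
        (S.commute_two_ascProd_bar_lt hM₀ R (by omega) (by omega)).symm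
    rw [ascProd_add, zero_add, ← mul_assoc, ← mul_assoc, this.eq]
  have h1 : ∀ k, i + 1 ≤ k → k < i + 1 + l → ∀ X,
      Commute (asym q (S.two · R) 0 (i + 1) * ascProd (S.bar F M₀) 0 (i + 1)) (S.one k X) :=
    fun k _ _ X => Commute.mul_left
      (commute_asym fun p _ _ => (S.commute_two_one (by omega) (by omega) (by omega) (by omega)
        R X).symm).symm (S.commute_ascProd_bar_one hM₀ X (by omega) (by omega))
  rw [mul_assoc, e, ← mul_assoc, S.qtraces_mul_left h1, S.qtraces_mul_right fun k _ hk X => ?_,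
    S.qtraces_asym_mul_ascProd_bar hM₀ hF hc hFF hR (-q⁻¹) (i + 1) (by omega)]
  rw [S.qtraces_asym_mul_ascProd_bar hM₀ hF hc hFF hR (-q⁻¹) (i + 1) (by omega)]
  rcases Nat.lt_or_ge k l with h' | h'
  · exact S.commute_qtraces_one _ (by omega) (by omega) (by omega)
  · refine (S.commute_qtraces (fun p _ _ Y => S.commute_one (by omega) (by omega) (by omega) X Y)
      (Commute.mul_left ?_ (S.commute_ascProd_bar_one hM₀ X (by omega) (by omega))).symm).symm
    exact (commute_asym fun i _ _ => (S.commute_two_one (by omega) (by omega) (by omega)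
      (by omega) R X).symm).symm

end SiteSystem
end QuantumMatrix

/-! ### Operators on consecutive sites -/

section Window

variable {K : Type*} [Field K] {A : Type*} [Ring A] [Algebra K A] {N m r i : ℕ}

/-- The `r` consecutive sites starting at `i`. -/
def windowSite (h : i + r ≤ m) (k : Fin r) : Fin m := ⟨i + k, by omega⟩

/-- Replace the labels of the sites `i, …, i + r - 1` in `a` by `d`. -/
def glue (i : ℕ) (d : Fin r → Fin N) (a : Fin m → Fin N) (k : Fin m) : Fin N :=
  if h : i ≤ k ∧ k < i + r then d ⟨k - i, by omega⟩ else a k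

theorem glue_comp (h : i + r ≤ m) (d : Fin r → Fin N) (a : Fin m → Fin N) :
    glue i d a ∘ windowSite h = d := by
  funext k
  simp [glue, windowSite]

theorem glue_apply_of_not {d : Fin r → Fin N} {a : Fin m → Fin N} {k : Fin m}
    (h : ↑k < i ∨ i + r ≤ k) : glue i d a k = a k := dif_neg (by omega)

theorem eq_glue (h : i + r ≤ m) {a b : Fin m → Fin N}
    (hab : ∀ k : Fin m, ↑k < i ∨ i + r ≤ k → a k = b k) : b = glue i (b ∘ windowSite h) a := by
  funext k
  by_cases hk : i ≤ k ∧ k < i + r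
  · rw [glue, dif_pos hk]
    exact congrArg b (Fin.ext (by simp [windowSite]; omega))
  · rw [glue_apply_of_not (by omega), hab k (by omega)]

/-- The entries of `window`. -/
def windowFun (h : i + r ≤ m) (X : Op N A r) : Op N A m := fun a b =>
  if ∀ k : Fin m, ↑k < i ∨ i + r ≤ k → a k = b k then
    X (a ∘ windowSite h) (b ∘ windowSite h) else 0

theorem windowFun_one (h : i + r ≤ m) : windowFun h (1 : Op N A r) = 1 := by
  ext a b
  by_cases hab : a = b
  · subst hab; simp [windowFun]
  · rw [one_apply_ne hab, windowFun]
    split_ifs with h'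
    · refine one_apply_ne fun h'' => hab ?_
      rw [eq_glue h h', ← h'', ← eq_glue h fun _ _ => rfl]
    · rfl

theorem windowFun_mul (h : i + r ≤ m) (X Y : Op N A r) :
    windowFun h (X * Y) = windowFun h X * windowFun h Y := by
  ext a c
  rw [mul_apply]
  by_cases hac : ∀ k : Fin m, ↑k < i ∨ i + r ≤ k → a k = c k
  · rw [windowFun, if_pos hac, mul_apply]
    refine Finset.sum_of_injOn (fun d => glue i d a) (fun d _ d' _ hd => ?_) (by simp)
      (fun b _ hb => ?_) (fun d _ => ?_)
    · rw [← glue_comp h d a, ← glue_comp h d' a]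
      exact congrArg (· ∘ windowSite h) hd
    · rw [windowFun, if_neg, zero_mul]
      exact fun hab => hb ⟨b ∘ windowSite h, by simp, (eq_glue h hab).symm⟩
    · rw [windowFun, windowFun, if_pos fun k hk => (glue_apply_of_not hk).symm,
        if_pos fun k hk => by rw [glue_apply_of_not hk, hac k hk], glue_comp]
  · rw [windowFun, if_neg hac]
    refine (Finset.sum_eq_zero fun b _ => ?_).symm
    by_cases hab : ∀ k : Fin m, ↑k < i ∨ i + r ≤ k → a k = b k
    · have : windowFun h Y b c = 0 :=
        if_neg fun hbc => hac fun k hk => (hab k hk).trans (hbc k hk)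
      rw [this, mul_zero]
    · rw [windowFun, if_neg hab, zero_mul]

variable (K) in
/-- The action of an operator on the `r` consecutive sites starting at `i`. -/
def window (h : i + r ≤ m) : Op N A r →ₐ[K] Op N A m :=
  AlgHom.ofLinearMap
    { toFun := windowFun h
      map_add' X Y := by
        ext a b
        simp only [windowFun, Matrix.add_apply]
        split_ifs <;> simp
      map_smul' c X := by
        ext a b
        simp only [windowFun, Matrix.smul_apply, RingHom.id_apply]
        split_ifs <;> simp }
    (windowFun_one h) (windowFun_mul h)

theorem window_apply (h : i + r ≤ m) (X : Op N A r) (a b : Fin m → Fin N) :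
    window K h X a b = if ∀ k : Fin m, ↑k < i ∨ i + r ≤ k → a k = b k then
      X (a ∘ windowSite h) (b ∘ windowSite h) else 0 := rfl

theorem window_window {m' i' : ℕ} (h : i + r ≤ m) (h' : i' + m ≤ m') (h'' : i' + i + r ≤ m')
    (X : Op N A r) : window K h' (window K h X) = window K h'' X := by
  ext a b
  rw [window_apply, window_apply, window_apply, ← ite_and]
  have e (c : Fin m' → Fin N) : (c ∘ windowSite h') ∘ windowSite h = c ∘ windowSite h'' := by
    funext k
    exact congrArg c (Fin.ext (by simp [windowSite, add_assoc]))
  rw [e, e]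
  refine if_congr ⟨fun H k hk => ?_, fun H => ⟨fun k hk => H k (by omega), fun k hk => H _ ?_⟩⟩
    rfl rfl
  · by_cases hk' : ↑k < i' ∨ i' + m ≤ k
    · exact H.1 k hk'
    · have := H.2 ⟨k - i', by omega⟩ (by simp; omega)
      have ek : windowSite h' ⟨k - i', by omega⟩ = k := Fin.ext (by simp [windowSite]; omega)
      simpa [ek] using this
  · simp [windowSite]; omega

theorem window_mul_window_apply {i' r' : ℕ} (h : i + r ≤ m) (h' : i' + r' ≤ m)
    (hd : i + r ≤ i' ∨ i' + r' ≤ i) (X : Op N A r) (Y : Op N A r') (a c : Fin m → Fin N) :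
    (window K h X * window K h' Y) a c =
      if ∀ k : Fin m, ↑k < i ∨ i + r ≤ k → ↑k < i' ∨ i' + r' ≤ k → a k = c k then
        X (a ∘ windowSite h) (c ∘ windowSite h) * Y (a ∘ windowSite h') (c ∘ windowSite h')
      else 0 := by
  rw [mul_apply, Finset.sum_eq_single (glue i (c ∘ windowSite h) a)]
  · rw [window_apply, window_apply, if_pos fun k hk => (glue_apply_of_not hk).symm, glue_comp,
      mul_ite, mul_zero]
    have e : glue i (c ∘ windowSite h) a ∘ windowSite h' = a ∘ windowSite h' :=
      funext fun k => glue_apply_of_not (by simp [windowSite]; omega)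
    rw [e]
    refine if_congr ⟨fun H k hk hk' => ?_, fun H k hk' => ?_⟩ rfl rfl
    · rw [← H k hk', glue_apply_of_not hk]
    · by_cases hk : ↑k < i ∨ i + r ≤ k
      · rw [glue_apply_of_not hk, H k hk hk']
      · rw [glue, dif_pos (by omega)]
        exact congrArg c (Fin.ext (by simp [windowSite]; omega))
  · intro b _ hb
    rw [window_apply, window_apply, ite_zero_mul_ite_zero, if_neg]
    rintro ⟨H, H'⟩
    refine hb ((eq_glue h H).trans (congrArg (glue i · a) (funext fun k => H' _ ?_)))
    simp [windowSite]; omega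
  · simp

theorem commute_window {i' r' : ℕ} (h : i + r ≤ m) (h' : i' + r' ≤ m)
    (hd : i + r ≤ i' ∨ i' + r' ≤ i) {X : Op N A r} {Y : Op N A r'}
    (hXY : ∀ a b c d, Commute (X a b) (Y c d)) : Commute (window K h X) (window K h' Y) := by
  ext a c
  rw [window_mul_window_apply h h' hd, window_mul_window_apply h' h hd.symm,
    (hXY _ _ _ _).eq]
  exact if_congr ⟨fun H k hk hk' => H k hk' hk, fun H k hk hk' => H k hk' hk⟩ rfl rfl

theorem window_injective [Nonempty (Fin N)] (h : i + r ≤ m) :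
    Function.Injective (window K h : Op N A r → Op N A m) := by
  intro X Y hXY
  ext a b
  have := congrFun₂ hXY (glue i a fun _ => Classical.arbitrary _)
    (glue i b fun _ => Classical.arbitrary _)
  rw [window_apply, window_apply, if_pos fun k hk => by
    rw [glue_apply_of_not hk, glue_apply_of_not hk], if_pos fun k hk => by
    rw [glue_apply_of_not hk, glue_apply_of_not hk]] at this
  simpa [glue_comp] using this

theorem window_smul_one (h : i + r ≤ m) (t : A) :
    window K h (t • (1 : Op N A r)) = t • 1 := by
  rw [← map_one (window K h)]
  ext a b
  simp only [window_apply, Matrix.smul_apply, smul_eq_mul, mul_ite, mul_zero]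

theorem site_eq_window (h : i + 2 ≤ m) (X : M2 N A) :
    site m i X = window K h (X.submatrix (finTwoArrowEquiv _) (finTwoArrowEquiv _)) := by
  ext a b
  rw [site, dif_pos (by omega), window_apply, mul_ite, mul_one, mul_zero]
  exact if_congr ⟨fun H k hk => H k (by omega) (by omega), fun H k _ _ => H k (by omega)⟩ rfl rfl

theorem site1_eq_window (h : i + 1 ≤ m) (X : Matrix (Fin N) (Fin N) A) :
    site1 m i X = window K h (X.submatrix (Equiv.funUnique (Fin 1) _) (Equiv.funUnique _ _)) := by
  ext a b
  rw [site1, dif_pos (by omega), window_apply, mul_ite, mul_one, mul_zero]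
  exact if_congr ⟨fun H k hk => H k (by omega), fun H k _ => H k (by omega)⟩ rfl rfl

variable {k : ℕ}

theorem window_site (h : i + r ≤ m) (hk : k + 1 < r) (X : M2 N A) :
    window K h (site r k X) = site m (i + k) X := by
  rw [site_eq_window (K := K) (by omega), window_window _ _ (by omega),
    site_eq_window (K := K) (by omega)]

theorem window_site1 (h : i + r ≤ m) (hk : k < r) (X : Matrix (Fin N) (Fin N) A) :
    window K h (site1 r k X) = site1 m (i + k) X := by
  rw [site1_eq_window (K := K) (by omega), window_window _ _ (by omega),
    site1_eq_window (K := K) (by omega)]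

end Window

/-! ### The system of sites of a tensor power -/

section OpSystem

variable {K : Type*} [Field K] {A : Type*} [Ring A] [Algebra K A] {N m r i : ℕ}

variable (K A N) in
/-- One-site operators as an algebra homomorphism. -/
noncomputable def oneHom (h : i + 1 ≤ m) : Matrix (Fin N) (Fin N) K →ₐ[K] Op N A m :=
  (window K h).comp ((AlgHom.mapMatrix (Algebra.ofId K A)).comp
    (reindexAlgEquiv K K (Equiv.funUnique (Fin 1) (Fin N)).symm).toAlgHom)

variable (K A N) in
/-- Two-site operators as an algebra homomorphism. -/
noncomputable def twoHom (h : i + 2 ≤ m) : M2 N K →ₐ[K] Op N A m :=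
  (window K h).comp ((AlgHom.mapMatrix (Algebra.ofId K A)).comp
    (reindexAlgEquiv K K (finTwoArrowEquiv (Fin N)).symm).toAlgHom)

theorem oneHom_apply (h : i + 1 ≤ m) (X : Matrix (Fin N) (Fin N) K) :
    oneHom K A N h X = site1 m i (X.map (algebraMap K A)) := by
  rw [site1_eq_window (K := K) h]; rfl

theorem twoHom_apply (h : i + 2 ≤ m) (X : M2 N K) :
    twoHom K A N h X = site m i (X.map (algebraMap K A)) := by
  rw [site_eq_window (K := K) h]; rfl

theorem site_kronecker_one (h : i + 1 < m) (X : Matrix (Fin N) (Fin N) K) :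
    site m i ((X ⊗ₖ (1 : Matrix (Fin N) (Fin N) K)).map (algebraMap K A)) =
      site1 m i (X.map (algebraMap K A)) := by
  ext a b
  rw [site, site1, dif_pos h, dif_pos (by omega)]
  simp only [map_apply, kronecker_apply, one_apply, mul_ite, mul_one, mul_zero]
  rw [apply_ite (algebraMap K A), map_zero, ← ite_and]
  refine if_congr ⟨fun H k hk => ?_, fun H => ⟨fun k hk _ => H k hk, H _ (by simp)⟩⟩ rfl rfl
  by_cases hk' : (k : ℕ) = i + 1
  · convert H.2
  · exact H.1 k hk hk'

theorem site_one_kronecker (h : i + 1 < m) (X : Matrix (Fin N) (Fin N) K) :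
    site m i (((1 : Matrix (Fin N) (Fin N) K) ⊗ₖ X).map (algebraMap K A)) =
      site1 m (i + 1) (X.map (algebraMap K A)) := by
  ext a b
  rw [site, site1, dif_pos h, dif_pos h]
  simp only [map_apply, kronecker_apply, one_apply, ite_mul, mul_ite, one_mul, mul_one, mul_zero,
    zero_mul]
  rw [apply_ite (algebraMap K A), map_zero, ← ite_and]
  refine if_congr ⟨fun H k hk => ?_, fun H => ⟨fun k _ hk => H k hk, H _ (by simp)⟩⟩ rfl rfl
  by_cases hk' : (k : ℕ) = i
  · convert H.2
  · exact H.1 k hk' hk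

variable (K A N) in
/-- The system of sites of `V^{⊗m}`. -/
noncomputable def opSystem (hm : 2 ≤ m) : SiteSystem K N (Op N A m) m where
  one i := if h : i + 1 ≤ m then oneHom K A N h else oneHom K A N (i := 0) (by omega)
  two i := if h : i + 2 ≤ m then twoHom K A N h else twoHom K A N (i := 0) (by omega)
  two_left i hi X := by
    have h1 : i + 2 ≤ m := hi
    have h2 : i + 1 ≤ m := by omega
    rw [dif_pos h1, dif_pos h2, oneHom_apply, twoHom_apply, site_kronecker_one hi]
  two_right i hi X := by
    have h1 : i + 2 ≤ m := hi
    have h2 : i + 1 + 1 ≤ m := hi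
    rw [dif_pos h1, dif_pos h2, oneHom_apply, twoHom_apply, site_one_kronecker hi]
  comm i j hij hj X Y := by
    rw [dif_pos (by omega), dif_pos (by omega)]
    exact commute_window (K := K) (A := A) _ _ (by omega) fun a b c d =>
      Algebra.commutes (A := A) _ _

theorem opSystem_one (hm : 2 ≤ m) (hi : i < m) (X : Matrix (Fin N) (Fin N) K) :
    (opSystem K A N hm).one i X = site1 m i (X.map (algebraMap K A)) := by
  rw [← oneHom_apply hi]
  exact DFunLike.congr_fun (dif_pos hi) X

theorem opSystem_two (hm : 2 ≤ m) (hi : i + 1 < m) (X : M2 N K) :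
    (opSystem K A N hm).two i X = site m i (X.map (algebraMap K A)) := by
  rw [← twoHom_apply hi]
  exact DFunLike.congr_fun (dif_pos hi) X

theorem site_map {B : Type*} [Ring B] [Algebra K B] (f : A →ₐ[K] B) (m i : ℕ) (X : M2 N A) :
    (site m i X).map f = site m i (X.map f) := by
  ext a b
  simp only [site, map_apply]
  split_ifs <;> simp

variable (K A N) in
/-- The extension of scalars followed by `window`. -/
noncomputable def scalarWindow (h : i + r ≤ m) : Op N K r →ₐ[K] Op N A m :=
  (window K h).comp (AlgHom.mapMatrix (Algebra.ofId K A))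

theorem scalarWindow_apply (h : i + r ≤ m) (X : Op N K r) :
    scalarWindow K A N h X = window K h (X.map (algebraMap K A)) := rfl

theorem scalarWindow_site (hm : 2 ≤ m) (h : i + r ≤ m) {k : ℕ} (hk : k + 1 < r) (X : M2 N K) :
    scalarWindow K A N h (site r k X) = (opSystem K A N hm).two (i + k) X := by
  rw [opSystem_two hm (by omega), ← window_site (K := K) h hk]
  exact congrArg (window K h) (site_map (Algebra.ofId K A) r k X)

variable {q : K} {R F : M2 N K}

theorem YB.two (hR : YB R) (hm : 2 ≤ m) (hi : i + 2 < m) :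
    (opSystem K A N hm).two i R * (opSystem K A N hm).two (i + 1) R * (opSystem K A N hm).two i R =
      (opSystem K A N hm).two (i + 1) R * (opSystem K A N hm).two i R *
        (opSystem K A N hm).two (i + 1) R := by
  have := congrArg (scalarWindow K A N (show i + 3 ≤ m from hi)) hR
  simpa [map_mul, scalarWindow_site hm] using this

theorem Compatible.mem_braided (h : Compatible R F) (hm : 2 ≤ m) :
    R ∈ (opSystem K A N hm).braided F := by
  intro i hi
  have h1 := congrArg (scalarWindow K A N (show i + 3 ≤ m from hi)) h.2.2.1
  have h2 := congrArg (scalarWindow K A N (show i + 3 ≤ m from hi)) h.2.2.2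
  simp only [map_mul, scalarWindow_site hm, Nat.one_lt_ofNat, Nat.reduceAdd,
    add_zero, zero_add, Nat.lt_add_one] at h1 h2
  exact ⟨by rw [← mul_assoc, h1], by rw [h2, mul_assoc]⟩

theorem Compatible.self (h : Compatible R F) : Compatible F F :=
  ⟨h.2.1, h.2.1, h.2.1, h.2.1⟩

theorem IsHecke.isHeckeSeq (hH : IsHecke q R) (hm : 2 ≤ m) :
    IsHeckeSeq q ((opSystem K A N hm).two · R) (m - 1) where
  quad i _ := by simp only [← map_mul, hH.2.2, map_add, map_one, map_smul]
  braid i hi := hH.2.1.two hm (by omega)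
  far i j hij hj := (opSystem K A N hm).commute_two_two hij (by omega) R R

variable (F) in
theorem window_Mbar (hm : 2 ≤ m) (h : 0 + r ≤ m) (M : Matrix (Fin N) (Fin N) A) : ∀ {k}, k < r →
    window K h (Mbar r (F.map (algebraMap K A)) ((F⁻¹).map (algebraMap K A)) M k) =
      (opSystem K A N hm).bar F (site1 m 0 M) k
  | 0, hk => window_site1 h hk M
  | k + 1, hk => by
    rw [Mbar, SiteSystem.bar, map_mul, map_mul, window_site h hk, window_site h hk,
      window_Mbar hm h M (by omega), opSystem_two hm (by omega), opSystem_two hm (by omega),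
      zero_add]

variable (F) in
theorem window_MbarSeg (hm : 2 ≤ m) (h : 0 + r ≤ m) (M : Matrix (Fin N) (Fin N) A) : ∀ {k}, k ≤ r →
    window K h (MbarSeg r (F.map (algebraMap K A)) ((F⁻¹).map (algebraMap K A)) M 0 k) =
      ascProd ((opSystem K A N hm).bar F (site1 m 0 M)) 0 k
  | 0, _ => map_one _
  | k + 1, hk => by
    rw [MbarSeg, ascProd, map_mul, window_MbarSeg hm h M (by omega), window_Mbar F hm h M (by omega)]

variable (R) in
theorem window_chain (hm : 2 ≤ m) (h : 0 + r ≤ m) : ∀ {k}, k + 1 ≤ r →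
    window K h (chain r (R.map (algebraMap K A)) 0 k) =
      ascProd ((opSystem K A N hm).two · R) 0 k
  | 0, _ => map_one _
  | k + 1, hk => by
    rw [chain, ascProd, map_mul, window_chain hm h (by omega), window_site h (by omega),
      opSystem_two hm (by omega), zero_add]

theorem qasym_eq_asym (q : K) (R : M2 N K) (m p : ℕ) :
    ∀ k, qasym q R m p k = asym q (site m · R) p k
  | 0 => rfl
  | 1 => rfl
  | k + 2 => by rw [qasym, asym, qasym_eq_asym]

theorem qsym_eq_asym (q : K) (R : M2 N K) (m p : ℕ) :
    ∀ k, qsym q R m p k = asym (-q⁻¹) (site m · R) p k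
  | 0 => rfl
  | 1 => rfl
  | k + 2 => by
    rw [qsym, asym, qsym_eq_asym, qInt_neg_inv, qInt_neg_inv, neg_pow q⁻¹, mul_inv]
    rcases neg_one_pow_eq_or K k with h | h <;> simp [pow_succ, h, sub_eq_add_neg]
    rw [← neg_add, mul_neg, neg_mul, smul_neg, neg_neg]

theorem window_asym (hm : 2 ≤ m) (h : 0 + r ≤ m) (q : K) (R : M2 N K) {k : ℕ} (hk : k ≤ r) :
    window K h ((asym q (site r · R) 0 k).map (algebraMap K A)) =
      asym q ((opSystem K A N hm).two · R) 0 k := by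
  rw [← scalarWindow_apply]
  exact map_asym _ _ fun i _ hi => by rw [scalarWindow_site hm h (by omega), zero_add]

theorem commute_site1_one (hm : 2 ≤ m) (M : Matrix (Fin N) (Fin N) A) (hi : 1 ≤ i) (him : i < m)
    (X : Matrix (Fin N) (Fin N) K) :
    Commute (site1 m 0 M) ((opSystem K A N hm).one i X) := by
  rw [opSystem_one hm him, site1_eq_window (K := K) (i := 0) (by omega),
    site1_eq_window (K := K) (i := i) (by omega)]
  exact commute_window _ _ (by omega) fun a b c d => (Algebra.commutes _ _).symm

end OpSystem

/-! ### Comparison of the quantum traces -/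

section Traces

variable {K : Type*} [Field K] {A : Type*} [Ring A] [Algebra K A] {N m r : ℕ}

theorem site1_mul_apply (i : Fin m) (X : Matrix (Fin N) (Fin N) A) (Y : Op N A m)
    (a b : Fin m → Fin N) :
    (site1 m i X * Y) a b = ∑ e, X (a i) e * Y (Function.update a i e) b := by
  rw [mul_apply]
  symm
  refine Finset.sum_of_injOn (fun e => Function.update a i e)
    (Function.update_injective a i).injOn (by simp) (fun d _ hd => ?_) (fun e _ => ?_)
  · rw [site1, dif_pos i.2, if_neg, mul_zero, zero_mul]
    refine fun h => hd ⟨d i, by simp, funext fun k => ?_⟩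
    rcases eq_or_ne k i with rfl | hk
    · simp
    · simpa [hk] using h k (Fin.val_ne_of_ne hk)
  · rw [site1, dif_pos i.2, if_pos, mul_one]
    · simp
    · intro k hk
      rw [Function.update_of_ne (Fin.ne_of_val_ne hk)]

theorem mul_site1_apply (i : Fin m) (X : Matrix (Fin N) (Fin N) A) (Y : Op N A m)
    (a b : Fin m → Fin N) :
    (Y * site1 m i X) a b = ∑ e, Y a (Function.update b i e) * X e (b i) := by
  rw [mul_apply]
  symm
  refine Finset.sum_of_injOn (fun e => Function.update b i e)
    (Function.update_injective b i).injOn (by simp) (fun d _ hd => ?_) (fun e _ => ?_)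
  · rw [site1, dif_pos i.2, if_neg, mul_zero, mul_zero]
    refine fun h => hd ⟨d i, by simp, funext fun k => ?_⟩
    rcases eq_or_ne k i with rfl | hk
    · simp
    · simpa [hk] using (h k (Fin.val_ne_of_ne hk)).symm
  · rw [site1, dif_pos i.2, if_pos, mul_one]
    · simp
    · intro k hk
      rw [Function.update_of_ne (Fin.ne_of_val_ne hk)]

theorem opSystem_qtrace_apply (hm : 2 ≤ m) (D : Matrix (Fin N) (Fin N) K) (i : Fin m)
    (Y : Op N A m) (a b : Fin m → Fin N) :
    (opSystem K A N hm).qtrace D i Y a b =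
      if a i = b i then ∑ v, ∑ e, algebraMap K A (D v e) *
        Y (Function.update a i e) (Function.update b i v) else 0 := by
  simp only [SiteSystem.qtrace_apply, subTrace_apply, opSystem_one hm i.2, Matrix.sum_apply,
    mul_site1_apply, site1_mul_apply, map_apply, single_apply, Function.update_self,
    Function.update_idem, apply_ite (algebraMap K A), map_zero, map_one, ite_and, ite_mul, mul_ite,
    zero_mul, mul_zero, one_mul, mul_one]
  simp [eq_comm]

theorem window_qtr1 (hm : 2 ≤ m) (h : 0 + r ≤ m) (h' : 0 + (r + 1) ≤ m)
    (D : Matrix (Fin N) (Fin N) K) (X : Op N A (r + 1)) :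
    window K h (qtr1 D X) = (opSystem K A N hm).qtrace D r (window K h' X) := by
  have hsnoc (a : Fin m → Fin N) (e : Fin N) :
      Function.update a (⟨r, by omega⟩ : Fin m) e ∘ windowSite h' =
        (Fin.snoc (a ∘ windowSite h) e : Fin (r + 1) → Fin N) := by
    funext k
    refine Fin.lastCases ?_ (fun k => ?_) k
    · rw [Fin.snoc_last, Function.comp_apply]
      convert Function.update_self (⟨r, by omega⟩ : Fin m) e a
      simp [windowSite]
    · rw [Fin.snoc_castSucc, Function.comp_apply, Function.update_of_ne]
      · rfl
      · simp [windowSite, Fin.ext_iff]; omega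
  ext a b
  rw [opSystem_qtrace_apply hm D (⟨r, by omega⟩ : Fin m)]
  simp only [window_apply, hsnoc]
  by_cases hr : a (⟨r, by omega⟩ : Fin m) = b (⟨r, by omega⟩ : Fin m)
  · rw [if_pos hr]
    have hP (v e : Fin N) : (∀ k : Fin m, (k : ℕ) < 0 ∨ 0 + (r + 1) ≤ k →
        Function.update a (⟨r, by omega⟩ : Fin m) e k =
          Function.update b (⟨r, by omega⟩ : Fin m) v k) ↔
        ∀ k : Fin m, (k : ℕ) < 0 ∨ 0 + r ≤ k → a k = b k := by
      refine ⟨fun H k hk => ?_, fun H k hk => ?_⟩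
      · by_cases hkr : (k : ℕ) = r
        · convert hr
        · have := H k (by omega)
          rwa [Function.update_of_ne (Fin.ne_of_val_ne hkr),
            Function.update_of_ne (Fin.ne_of_val_ne hkr)] at this
      · have hkr : (k : ℕ) ≠ r := by omega
        rw [Function.update_of_ne (Fin.ne_of_val_ne hkr),
            Function.update_of_ne (Fin.ne_of_val_ne hkr), H k (by omega)]
    simp only [hP]
    split_ifs
    · rfl
    · simp
  · rw [if_neg hr, if_neg fun H => hr (H _ (Or.inr (by simp)))]

theorem window_qtrs (hm : 2 ≤ m) (D : Matrix (Fin N) (Fin N) K) {s : ℕ} (h : 0 + s ≤ m) :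
    ∀ {j} (h' : 0 + (s + j) ≤ m) (X : Op N A (s + j)),
      window K h (qtrs D s j X) = (opSystem K A N hm).qtraces D s j (window K h' X)
  | 0, _, _ => rfl
  | j + 1, h', X => by
    rw [qtrs, window_qtrs hm D h (Nat.le_of_succ_le h'), SiteSystem.qtraces_succ,
      window_qtr1 hm (Nat.le_of_succ_le h') h']
    rfl

theorem sum_snoc {P : Type*} [AddCommMonoid P] (f : (Fin (r + 1) → Fin N) → P) :
    ∑ a, f a = ∑ c : Fin N, ∑ a : Fin r → Fin N, f (Fin.snoc a c) := by
  rw [← (Fin.snocEquiv fun _ => Fin N).sum_comp, Fintype.sum_prod_type]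
  rfl

theorem qtrAll_qtr1 (D : Matrix (Fin N) (Fin N) K) (X : Op N A (r + 1)) :
    qtrAll D (qtr1 D X) = qtrAll D X := by
  symm
  simp only [qtrAll, qtr1, sum_snoc (r := r), Fin.prod_univ_castSucc, Fin.snoc_castSucc,
    Fin.snoc_last, map_mul, Finset.mul_sum, mul_assoc]
  rw [Finset.sum_comm]
  refine Finset.sum_congr rfl fun a _ => ?_
  symm
  rw [Finset.sum_comm]
  exact Finset.sum_congr rfl fun c _ => Finset.sum_comm

theorem qtraces_window (hm : 2 ≤ m) (D : Matrix (Fin N) (Fin N) K) :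
    ∀ {l} (h : 0 + l ≤ m) (X : Op N A l),
      (opSystem K A N hm).qtraces D 0 l (window K h X) = qtrAll D X • 1
  | 0, h, X => by
    have hX : X = qtrAll D X • 1 := by
      ext a b
      simp [qtrAll, Subsingleton.elim a default, Subsingleton.elim b default]
    conv_lhs => rw [hX]
    exact window_smul_one (K := K) h _
  | l + 1, h, X => by
    rw [SiteSystem.qtraces_succ, ← qtrAll_qtr1, ← qtraces_window hm D (by omega),
      window_qtr1 hm _ h]
    simp only [zero_add]

end Traces

end Sites

/-! ### The identities -/

section Final

variable {K : Type*} [Field K] {A : Type*} [Ring A] [Algebra K A] {N m : ℕ}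
  {R F Ψ : M2 N K} {M : Matrix (Fin N) (Fin N) A} {q : K}

theorem IsGenerators.two_mul (hM : IsGenerators R F M) (hm : 2 ≤ m) :
    (opSystem K A N hm).two 0 R * (site1 m 0 M * (opSystem K A N hm).bar F (site1 m 0 M) 1) =
      site1 m 0 M * (opSystem K A N hm).bar F (site1 m 0 M) 1 *
        (opSystem K A N hm).two 0 (RFF R F) := by
  have := congrArg (window K (show 0 + 2 ≤ m by omega)) hM
  simpa [map_mul, window_site, window_MbarSeg F hm, ← opSystem_two hm (show 0 + 1 < m by omega),
    ascProd, SiteSystem.bar] using this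

theorem MpowF_eq_sum (hF : IsUnit F) (hΨ : IsClosedPair F Ψ) (h : Compatible R F)
    (hM : IsGenerators R F M) (hq : q ≠ 0) (hqn : ∀ n, 1 ≤ n → qInt q n ≠ 0) (hq1 : q - q⁻¹ ≠ 0)
    (hH : ∀ {m} (hm : 2 ≤ m), IsHeckeSeq q ((opSystem K A N hm).two · R) (m - 1)) (j : ℕ) :
    MpowF R F Ψ M j =
      ∑ i ∈ Finset.range (j + 1), ((-1 : K) ^ i * q ^ (j - i) * qInt q (i + 1)) •
        (qtrs (Dmat Ψ) 1 i ((asym q (site (1 + i) · R) 0 (i + 1)).map (algebraMap K A) *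
            MbarSeg (1 + i) (F.map (algebraMap K A)) ((F⁻¹).map (algebraMap K A)) M 0 (i + 1)) *
          (qtrAll (Dmat Ψ) ((asym (-q⁻¹) (site (j - i) · R) 0 (j - i)).map (algebraMap K A) *
            MbarSeg (j - i) (F.map (algebraMap K A)) ((F⁻¹).map (algebraMap K A)) M 0 (j - i)) •
              (1 : Op N A 1))) := by
  rcases isEmpty_or_nonempty (Fin N) with _ | _
  · exact Subsingleton.elim _ _
  have hm : 2 ≤ j + 2 := by omega
  have h1 : 0 + 1 ≤ j + 2 := by omega
  refine window_injective (K := K) (A := A) h1 ?_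
  have hF4 : F ∈ (opSystem K K N (m := 4) (by norm_num)).braided F := h.self.mem_braided _
  have hR4 : R ∈ (opSystem K K N (m := 4) (by norm_num)).braided F := h.mem_braided _
  have key := (opSystem K A N hm).qtraces_ascProd_eq_sum (M₀ := site1 (j + 2) 0 M)
    (fun i hi him X => commute_site1_one hm M hi him X) hF
    (SiteSystem.ptrace_conj (by norm_num) hΨ hF hF4)
    (SiteSystem.kronecker_mul_eq (by norm_num) hΨ hF hF4 hR4)
    (h.self.mem_braided hm) (h.mem_braided hm)
    (SiteSystem.RFF_mem (h.mem_braided hm) (h.self.mem_braided hm) hF) (hM.two_mul hm) hq hqn hq1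
    (hH hm) (show j < j + 2 by omega)
  rw [MpowF, window_qtrs hm _ h1 (by omega), map_mul, window_chain R hm _ (by omega),
    window_MbarSeg F hm _ _ (by omega), key, map_sum]
  refine Finset.sum_congr rfl fun i hi => ?_
  have hi' : i ≤ j := Nat.lt_succ_iff.1 (Finset.mem_range.1 hi)
  symm
  rw [map_smul, map_mul, window_smul_one, window_qtrs hm _ h1 (by omega), map_mul,
    window_asym hm _ _ _ (by omega), window_MbarSeg F hm _ _ (by omega),
    ← qtraces_window hm _ (show 0 + (j - i) ≤ j + 2 by omega), map_mul (window K _),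
    window_asym hm _ _ _ le_rfl, window_MbarSeg F hm _ _ le_rfl]

end Final

/-- Inverse Cayley–Hamilton–Newton identities.  For a Hecke
R-matrix `R̂`, a compatible closed R-matrix `F̂` and a matrix of generators `M`
of `M(R̂,F̂)`:  for every `k = j+1 ≥ 1`,
`M^{\overline{k}} = ∑_{i=1}^{k} (−1)^{i+1} q^{k−i} i_q M^{∧i} τ_{k−i}(M)
              = ∑_{i=1}^{k} (−1)^{k−i} q^{i−k} i_q M^{Si} σ_{k−i}(M)`
(below the summation index is shifted, `i = i' + 1` with `i' ∈ range (j+1)`). -/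
theorem inverse_CHN {K : Type} [Field K] {A : Type} [Ring A] [Algebra K A]
    {N : ℕ} (q : K) (R F Ψ : M2 N K) (M : Matrix (Fin N) (Fin N) A)
    (hq0 : q ≠ 0) (hq1 : q ^ 2 ≠ 1) (hqn : ∀ n : ℕ, 1 ≤ n → qInt q n ≠ 0)
    (hH : IsHecke q R) (hF : IsUnit F) (hΨ : IsClosedPair F Ψ)
    (h : Compatible R F) (hM : IsGenerators R F M) :
    ∀ j : ℕ,
      MpowF R F Ψ M j =
        ∑ i ∈ Finset.range (j + 1),
          ((-1 : K) ^ i * q ^ (j - i) * qInt q (i + 1)) •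
            (MwedgeF q R F Ψ M i * (tauF q R F Ψ M (j - i) • (1 : Op N A 1))) ∧
      MpowF R F Ψ M j =
        ∑ i ∈ Finset.range (j + 1),
          ((-1 : K) ^ (j - i) * (q⁻¹) ^ (j - i) * qInt q (i + 1)) •
            (MsymF q R F Ψ M i * (sigmaF q R F Ψ M (j - i) • (1 : Op N A 1))) := by
  have hq : q - q⁻¹ ≠ 0 := fun H => hq1 <| by
    rw [sq]; nth_rw 1 [sub_eq_zero.1 H]; exact inv_mul_cancel₀ hq0
  simp only [MwedgeF, tauF, MsymF, sigmaF, qasym_eq_asym, qsym_eq_asym]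
  refine fun j => ⟨MpowF_eq_sum hF hΨ h hM hq0 hqn hq (fun hm => hH.isHeckeSeq hm) j, ?_⟩
  rw [MpowF_eq_sum (q := -q⁻¹) hF hΨ h hM (by simpa using hq0) (qInt_neg_inv_ne_zero hqn)
    (by rwa [neg_inv_sub_inv]) (fun hm => (hH.isHeckeSeq hm).neg_inv) j]
  refine Finset.sum_congr rfl fun i _ => ?_
  rw [inv_neg, inv_inv, neg_neg, qInt_neg_inv, neg_pow q⁻¹]
  congr 1
  have hi : (-1 : K) ^ i * (-1) ^ i = 1 := by rw [← mul_pow]; simp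
  linear_combination ((-1 : K) ^ (j - i) * q⁻¹ ^ (j - i) * qInt q (i + 1)) * hi

end CHN
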